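/- For every maximal w-collection F in 2^[n], there is a finite sequence F_0 = I_n, F_1, …, F_t = F of maximal w-collections in 2^[n] such that for each s = 1, …, t the collection F_s is obtained from F_{s−1} by a weak raising flip. In particular, the interval collection I_n is itself a maximal w-collection in 2^[n]. -/

import Mathlib

open Finset

/-- max of a finite set of naturals, with the convention `max0 ∅ = 0`. -/
def max0 (A : Finset ℕ) : ℕ := if h : A.Nonempty then A.max' h else 0

/-- min of a finite set of naturals, with the convention `min0 ∅ = 0`. -/
def min0 (A : Finset ℕ) : ℕ := if h : A.Nonempty then A.min' h else 0

/-- `A < B` : global dominating, i.e. `max A < min B` (with `min ∅ = max ∅ = 0`). -/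
def SetLT (A B : Finset ℕ) : Prop := max0 A < min0 B

/-- `A ⋖ B` : global dominating after cancelations, i.e. `(A − B) < (B − A)`. -/
def LessDot (A B : Finset ℕ) : Prop := SetLT (A \ B) (B \ A)

/-- `A ▷ B` (splitting): `A − B ≠ ∅` and `B − A` is a union of nonempty subsets
`B′, B″` with `B′ < (A − B) < B″`. -/
def Splits (A B : Finset ℕ) : Prop :=
  (A \ B).Nonempty ∧ ∃ B' B'' : Finset ℕ, B'.Nonempty ∧ B''.Nonempty ∧
    B' ∪ B'' = B \ A ∧ SetLT B' (A \ B) ∧ SetLT (A \ B) B''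

/-- `A` and `B` are strongly separated. -/
def StronglySep (A B : Finset ℕ) : Prop := LessDot A B ∨ LessDot B A ∨ A = B

/-- `A` and `B` are weakly separated. -/
def WeaklySep (A B : Finset ℕ) : Prop :=
  StronglySep A B ∨ (Splits A B ∧ B.card ≤ A.card) ∨ (Splits B A ∧ A.card ≤ B.card)

/-- a w-collection: members are pairwise weakly separated. -/
def IsWColl (F : Finset (Finset ℕ)) : Prop := ∀ A ∈ F, ∀ B ∈ F, WeaklySep A B

/-- a maximal w-collection in the domain `D`. -/
def IsMaxWColl (D : Set (Finset ℕ)) (F : Finset (Finset ℕ)) : Prop :=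
  ↑F ⊆ D ∧ IsWColl F ∧
    ∀ G : Finset (Finset ℕ), ↑G ⊆ D → IsWColl G → F ⊆ G → F = G

/-- the domain `D` is w-pure: all maximal w-collections in `D` have the same cardinality. -/
def WPure (D : Set (Finset ℕ)) : Prop :=
  ∀ F G : Finset (Finset ℕ), IsMaxWColl D F → IsMaxWColl D G → F.card = G.card

/-- an s-collection: members are pairwise strongly separated. -/
def IsSColl (F : Finset (Finset ℕ)) : Prop := ∀ A ∈ F, ∀ B ∈ F, StronglySep A B

/-- a maximal s-collection in the domain `D`. -/
def IsMaxSColl (D : Set (Finset ℕ)) (F : Finset (Finset ℕ)) : Prop :=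
  ↑F ⊆ D ∧ IsSColl F ∧
    ∀ G : Finset (Finset ℕ), ↑G ⊆ D → IsSColl G → F ⊆ G → F = G

/-- the domain `D` is s-pure: all maximal s-collections in `D` have the same cardinality. -/
def SPure (D : Set (Finset ℕ)) : Prop :=
  ∀ F G : Finset (Finset ℕ), IsMaxSColl D F → IsMaxSColl D G → F.card = G.card

/-- `I_n`: the collection of all intervals `{p,…,q} ⊆ [n]` together with `∅`. -/
def IntervalColl (n : ℕ) : Finset (Finset ℕ) :=
  insert ∅ ((Finset.Icc 1 n ×ˢ Finset.Icc 1 n).image fun p => Finset.Icc p.1 p.2)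

/-- `F′` is obtained from `F` by a weak raising flip. -/
def WeakRaisingFlip (n : ℕ) (F F' : Finset (Finset ℕ)) : Prop :=
  ∃ i j k : ℕ, ∃ A : Finset ℕ,
    i ∈ Finset.Icc 1 n ∧ j ∈ Finset.Icc 1 n ∧ k ∈ Finset.Icc 1 n ∧
    i < j ∧ j < k ∧ A ⊆ Finset.Icc 1 n ∧ i ∉ A ∧ j ∉ A ∧ k ∉ A ∧
    insert i A ∈ F ∧ insert k A ∈ F ∧ insert i (insert j A) ∈ F ∧
    insert j (insert k A) ∈ F ∧ insert j A ∈ F ∧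
    F' = insert (insert i (insert k A)) (F.erase (insert j A))

/-- `P` and `Q` do not alternate along four increasing positions. -/
def AltFree {α : Type*} [LinearOrder α] (P Q : Set α) : Prop :=
  ∀ p q r s, p < q → q < r → r < s →
    ¬ (p ∈ P ∧ p ∉ Q ∧ q ∈ Q ∧ q ∉ P ∧ r ∈ P ∧ r ∉ Q ∧ s ∈ Q ∧ s ∉ P) ∧
    ¬ (p ∈ Q ∧ p ∉ P ∧ q ∈ P ∧ q ∉ Q ∧ r ∈ Q ∧ r ∉ P ∧ s ∈ P ∧ s ∉ Q)

namespace AltFree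

variable {α : Type*} [LinearOrder α] {P Q : Set α}

theorem symm (h : AltFree P Q) : AltFree Q P := fun p q r s h1 h2 h3 =>
  ⟨(h p q r s h1 h2 h3).2, (h p q r s h1 h2 h3).1⟩

theorem compl (h : AltFree P Q) : AltFree Pᶜ Qᶜ := by
  intro p q r s h1 h2 h3
  have := h p q r s h1 h2 h3
  simp only [Set.mem_compl_iff]
  tauto

/-- Cyclic form of alternation-freeness. -/
theorem cyc (h : AltFree P Q) {p q r s : α}
    (hc : p < q ∧ q < r ∧ r < s ∨ q < r ∧ r < s ∧ s < p ∨ r < s ∧ s < p ∧ p < q ∨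
      s < p ∧ p < q ∧ q < r)
    (hp : p ∈ P) (hp' : p ∉ Q) (hq : q ∈ Q) (hq' : q ∉ P)
    (hr : r ∈ P) (hr' : r ∉ Q) (hs : s ∈ Q) (hs' : s ∉ P) : False := by
  rcases hc with ⟨h1, h2, h3⟩ | ⟨h1, h2, h3⟩ | ⟨h1, h2, h3⟩ | ⟨h1, h2, h3⟩
  · exact (h _ _ _ _ h1 h2 h3).1 ⟨hp, hp', hq, hq', hr, hr', hs, hs'⟩
  · exact (h _ _ _ _ h1 h2 h3).2 ⟨hq, hq', hr, hr', hs, hs', hp, hp'⟩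
  · exact (h _ _ _ _ h1 h2 h3).1 ⟨hr, hr', hs, hs', hp, hp', hq, hq'⟩
  · exact (h _ _ _ _ h1 h2 h3).2 ⟨hs, hs', hp, hp', hq, hq', hr, hr'⟩

theorem dual (h : AltFree P Q) : AltFree (α := αᵒᵈ) P Q := by
  intro p q r s h1 h2 h3
  have := h s r q p h3 h2 h1
  constructor
  · rintro ⟨a1, a2, a3, a4, a5, a6, a7, a8⟩
    exact this.2 ⟨a7, a8, a5, a6, a3, a4, a1, a2⟩
  · rintro ⟨a1, a2, a3, a4, a5, a6, a7, a8⟩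
    exact this.1 ⟨a7, a8, a5, a6, a3, a4, a1, a2⟩

end AltFree

section Coverage

variable {α : Type*} [LinearOrder α]

/-- `V` shows that `y` cannot be dropped, with neighbours `i`, `j` in `T ∪ {b, a}`
and an outer element `w`. -/
def Wit (b a : α) (Z : Set α) (T : Finset α) (V : Set α) (i y j w : α) : Prop :=
  i < y ∧ y < j ∧ (i ∈ T ∨ i = b) ∧ (j ∈ T ∨ j = a) ∧ y ∈ V ∧ i ∉ V ∧ j ∉ V ∧ w ∈ V ∧ w ∉ Z ∧
    (w < i ∨ j < w)

def Cov (b a : α) (Z : Set α) (F : Set (Set α)) (T : Finset α) (y : α) : Prop :=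
  ∃ V ∈ F, ∃ i j w, Wit b a Z T V i y j w

def Up (b a : α) (Z : Set α) (F : Set (Set α)) (T : Finset α) (i y : α) : Prop :=
  i < y ∧ ∀ V ∈ F, ∀ i' j w, Wit b a Z T V i' y j w → i' = i

def Down (b a : α) (Z : Set α) (F : Set (Set α)) (T : Finset α) (j y : α) : Prop :=
  y < j ∧ ∀ V ∈ F, ∀ i j' w, Wit b a Z T V i y j' w → j' = j

theorem Wit.dual {b a : α} {Z : Set α} {T : Finset α} {V : Set α} {i y j w : α} :
    Wit (α := αᵒᵈ) a b Z T V j y i w ↔ Wit b a Z T V i y j w := by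
  unfold Wit
  constructor
  · rintro ⟨h1, h2, h3, h4, h5, h6, h7, h8, h9, h10⟩
    exact ⟨h2, h1, h4, h3, h5, h7, h6, h8, h9, h10.symm⟩
  · rintro ⟨h1, h2, h3, h4, h5, h6, h7, h8, h9, h10⟩
    exact ⟨h2, h1, h4, h3, h5, h7, h6, h8, h9, h10.symm⟩

theorem Cov.dual {b a : α} {Z : Set α} {F : Set (Set α)} {T : Finset α} {y : α} :
    Cov (α := αᵒᵈ) a b Z F T y ↔ Cov b a Z F T y := by
  constructor
  · rintro ⟨V, hV, i, j, w, h⟩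
    exact ⟨V, hV, j, i, w, Wit.dual.1 h⟩
  · rintro ⟨V, hV, i, j, w, h⟩
    exact ⟨V, hV, j, i, w, Wit.dual.2 h⟩

theorem Up.dual {b a : α} {Z : Set α} {F : Set (Set α)} {T : Finset α} {i y : α} :
    Up (α := αᵒᵈ) a b Z F T i y ↔ Down b a Z F T i y :=
  ⟨fun h => ⟨h.1, fun V hV i' j' w hw => h.2 V hV j' i' w (Wit.dual.2 hw)⟩,
    fun h => ⟨h.1, fun V hV i' j' w hw => h.2 V hV j' i' w (Wit.dual.1 hw)⟩⟩

theorem Down.dual {b a : α} {Z : Set α} {F : Set (Set α)} {T : Finset α} {i y : α} :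
    Down (α := αᵒᵈ) a b Z F T i y ↔ Up b a Z F T i y :=
  ⟨fun h => ⟨h.1, fun V hV i' j' w hw => h.2 V hV j' i' w (Wit.dual.2 hw)⟩,
    fun h => ⟨h.1, fun V hV i' j' w hw => h.2 V hV j' i' w (Wit.dual.1 hw)⟩⟩

theorem up_or_down_of_erase {b a : α} {Z : Set α} {F : Set (Set α)} {T : Finset α} {i y : α}
    (hy : y ∈ T.erase i) (hn : ¬ Cov b a Z F (T.erase i) y) :
    Up b a Z F T i y ∨ Down b a Z F T i y := by
  have hne : y ≠ i := (Finset.mem_erase.1 hy).1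
  rcases lt_or_gt_of_ne hne with h | h
  · right
    refine ⟨h, fun V hV i' j w hw => ?_⟩
    by_contra hj
    refine hn ⟨V, hV, i', j, w, ?_⟩
    unfold Wit at *
    simp only [Finset.mem_erase]
    grind
  · left
    refine ⟨h, fun V hV i' j w hw => ?_⟩
    by_contra hj
    refine hn ⟨V, hV, i', j, w, ?_⟩
    unfold Wit at *
    simp only [Finset.mem_erase]
    grind

/-- Hypotheses shared by the covering lemmas. -/
structure CovData (b a : α) (Z : Set α) (F : Set (Set α)) (T : Finset α) : Prop where
  hb : b ∈ Z
  ha : a ∈ Z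
  pair : ∀ V ∈ F, ∀ W ∈ F, AltFree V W
  sepZ : ∀ V ∈ F, AltFree V Z
  T_sub : ∀ t ∈ T, t ∈ Z ∧ b < t ∧ t < a

theorem CovData.dual {b a : α} {Z : Set α} {F : Set (Set α)} {T : Finset α}
    (h : CovData b a Z F T) : CovData (α := αᵒᵈ) a b Z F T :=
  ⟨h.ha, h.hb, fun V hV W hW => (h.pair V hV W hW).dual, fun V hV => (h.sepZ V hV).dual,
    fun t ht => ⟨(h.T_sub t ht).1, (h.T_sub t ht).2.2, (h.T_sub t ht).2.1⟩⟩

theorem CovData.mono {b a : α} {Z : Set α} {F F' : Set (Set α)} {T T' : Finset α}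
    (h : CovData b a Z F T) (hF : F' ⊆ F) (hT : T' ⊆ T) : CovData b a Z F' T' :=
  ⟨h.hb, h.ha, fun V hV W hW => h.pair V (hF hV) W (hF hW), fun V hV => h.sepZ V (hF hV),
    fun t ht => h.T_sub t (hT ht)⟩

theorem up_down_false {b a : α} {Z : Set α} {F : Set (Set α)} {T : Finset α}
    (D : CovData b a Z F T) (hc : ∀ y ∈ T, Cov b a Z F T y)
    {i y z : α} (hi : i ∈ T) (hy : y ∈ T) (hz : z ∈ T)
    (hu : Up b a Z F T i y) (hd : Down b a Z F T y z) : False := by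
  obtain ⟨V, hV, i1, t, w, hw⟩ := hc y hy
  obtain rfl := hu.2 V hV _ _ _ hw
  obtain ⟨V', hV', s, y1, w', hw'⟩ := hc z hz
  obtain rfl := hd.2 V' hV' _ _ _ hw'
  obtain ⟨hiy, hU⟩ := hu
  obtain ⟨hzy, hD⟩ := hd
  have hti := D.T_sub _ hi
  have hty := D.T_sub _ hy
  have htz := D.T_sub _ hz
  obtain ⟨-, k2, k3, k4, k5, k6, k7, k8, k9, k10⟩ := hw
  obtain ⟨l1, -, l3, l4, l5, l6, l7, l8, l9, l10⟩ := hw'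
  have hsZ : s ∈ Z := by
    rcases l3 with h | rfl
    · exact (D.T_sub _ h).1
    · exact D.hb
  have htZ : t ∈ Z := by
    rcases k4 with h | rfl
    · exact (D.T_sub _ h).1
    · exact D.ha
  rcases lt_or_ge i1 z with h | h
  · by_cases hzV : z ∈ V
    · have := hD V hV i1 t w ⟨h, hzy.trans k2, Or.inl hi, k4, hzV, k6, k7, k8, k9, k10⟩
      exact absurd this k2.ne'
    · have := hU V hV z t w ⟨hzy, k2, Or.inl hz, k4, k5, hzV, k7, k8, k9, by grind⟩
      exact absurd this h.ne'
  · have hiV' : i1 ∈ V' := by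
      by_contra hiV'
      have hne : i1 ≠ z := by rintro rfl; exact hiV' l5
      have := hD V' hV' s i1 w' ⟨l1, lt_of_le_of_ne h hne.symm, l3, Or.inl hi, l5, l6, hiV', l8, l9,
        by grind⟩
      exact absurd this hiy.ne
    have hsi : s < i1 := lt_of_lt_of_le l1 h
    obtain ⟨p, hp1, hp2, hp3, hp4⟩ : ∃ p, p ∈ V ∧ p ∉ V' ∧ p < i1 ∧ s ≤ p := by
      by_cases hsV : s ∈ V
      · exact ⟨s, hsV, l6, hsi, le_rfl⟩
      · have hws : s < w ∧ w < i1 := by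
          by_contra hcon
          have := hU V hV s t w ⟨hsi.trans hiy, k2, l3, k4, k5, hsV, k7, k8, k9, by grind⟩
          exact absurd this hsi.ne
        refine ⟨w, k8, fun hwV' => ?_, hws.2, hws.1.le⟩
        exact (D.sepZ V' hV').symm.cyc (p := s) (q := w) (r := y1) (s := w') (by grind)
          hsZ l6 hwV' k9 hty.1 l7 l8 l9
    obtain ⟨r, hr1, hr2, hr3, hr4⟩ : ∃ r, r ∈ V' ∧ r ∉ V ∧ y1 < r ∧ (s ≤ p) := by
      by_cases htV : t ∈ V'
      · exact ⟨t, htV, k7, k2, hp4⟩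
      · have hws : y1 < w' ∧ w' < t := by
          by_contra hcon
          have := hD V' hV' s t w' ⟨l1, hzy.trans k2, l3, k4, l5, l6, htV, l8, l9, by grind⟩
          exact absurd this k2.ne'
        refine ⟨w', l8, fun hwV' => ?_, hws.1, hp4⟩
        exact (D.sepZ V hV).symm.cyc (p := i1) (q := w') (r := t) (s := w) (by grind)
          hti.1 k6 hwV' l9 htZ k7 k8 k9
    exact (D.pair V hV V' hV').cyc (p := p) (q := i1) (r := y1) (s := r)
      (Or.inl ⟨hp3, hiy, hr3⟩) hp1 hp2 hiV' k6 k5 l7 hr1 hr2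

theorem down_up_false {b a : α} {Z : Set α} {F : Set (Set α)} {T : Finset α}
    (D : CovData b a Z F T) (hc : ∀ y ∈ T, Cov b a Z F T y)
    {i y z : α} (hi : i ∈ T) (hy : y ∈ T) (hz : z ∈ T)
    (hu : Down b a Z F T i y) (hd : Up b a Z F T y z) : False :=
  up_down_false D.dual (fun y hy => Cov.dual.2 (hc y hy)) hi hy hz (Up.dual.2 hu) (Down.dual.2 hd)

/-- Not every element can be deletable. -/
theorem not_all_deletable {b a : α} {Z : Set α} {F : Set (Set α)} {T : Finset α}
    (D : CovData b a Z F T) (hne : T.Nonempty) (hc : ∀ y ∈ T, Cov b a Z F T y)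
    (hdel : ∀ i ∈ T, ∃ y ∈ T, Up b a Z F T i y ∨ Down b a Z F T i y) : False := by
  classical
  have hS : (T.filter fun i => ∃ y ∈ T, Up b a Z F T i y).Nonempty := by
    refine ⟨T.min' hne, Finset.mem_filter.2 ⟨T.min'_mem hne, ?_⟩⟩
    obtain ⟨y, hy, h | h⟩ := hdel _ (T.min'_mem hne)
    · exact ⟨y, hy, h⟩
    · exact absurd h.1 (not_lt.2 (T.min'_le y hy))
  obtain ⟨hi, y, hy, hu⟩ := Finset.mem_filter.1 (Finset.max'_mem _ hS)
  obtain ⟨z, hz, h | h⟩ := hdel y hy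
  · exact absurd hu.1 (not_lt.2 (Finset.le_max' _ _ (Finset.mem_filter.2 ⟨hy, z, hz, h⟩)))
  · exact up_down_false D hc hi hy hz hu h

theorem exists_not_cov_of_no_straddle {b a : α} {Z : Set α} {F : Set (Set α)} {T : Finset α}
    (D : CovData b a Z F T) (hne : T.Nonempty)
    (hI : ∀ V ∈ F, b ∉ V → a ∉ V → ∀ w ∈ V, w ∉ Z → ¬ (w < b ∨ a < w)) :
    ∃ y ∈ T, ¬ Cov b a Z F T y := by
  classical
  induction T using Finset.strongInduction with
  | H T ih =>
    by_contra! hc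
    by_cases h1 : ∃ i, T = {i}
    · obtain ⟨i, rfl⟩ := h1
      obtain ⟨V, hV, d, d', w, hw⟩ := hc i (by simp)
      unfold Wit at hw
      have h1 : d = b := by grind
      have h2 : d' = a := by grind
      subst h1 h2
      obtain ⟨-, -, -, -, k5, k6, k7, k8, k9, k10⟩ := hw
      exact hI V hV k6 k7 w k8 k9 k10
    · refine not_all_deletable D hne hc fun i hi => ?_
      have hne' : (T.erase i).Nonempty := by
        rw [Finset.nonempty_iff_ne_empty]
        intro h
        rw [Finset.erase_eq_empty_iff] at h
        rcases h with h | h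
        · exact hne.ne_empty h
        · exact h1 ⟨i, h⟩
      obtain ⟨y, hy, hn⟩ := ih _ (Finset.erase_ssubset hi)
        (D.mono subset_rfl (Finset.erase_subset _ _)) hne'
      exact ⟨y, Finset.mem_of_mem_erase hy, up_or_down_of_erase hy hn⟩

end Coverage

section Coverage2

variable {α : Type*} [LinearOrder α]

/-- If `V₂` misses the single element `i₀` of `T`, members straddling `[b, a]` avoid `T` above `i₀`. -/
theorem straddle_avoids_up {b a i₀ w₁ : α} {Z V₁ V₂ : Set α} {F : Set (Set α)} {T : Finset α}
    (D : CovData b a Z F T) (hV₂ : V₂ ∈ F) (hb₂ : b ∈ V₂) (ha₂ : a ∈ V₂)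
    (hi₀' : i₀ ∉ V₂) (hother : ∀ t ∈ T, t ≠ i₀ → t ∈ V₂)
    (hc : ∀ y ∈ T, Cov b a Z F T y)
    (hdown : ∀ i ∈ T, i₀ < i → ∃ z ∈ T, i₀ ≤ z ∧ Down b a Z F T i z)
    (hV₁ : V₁ ∈ F) (hb₁ : b ∉ V₁) (ha₁ : a ∉ V₁) (hst : ∃ w ∈ V₁, w ∉ Z ∧ (w < b ∨ a < w))
    (hsub : i₀ ∉ V₁) (hw₁ : w₁ ∈ V₁) (hw₁' : w₁ ∉ V₂) (hw₁o : w₁ < b ∨ a < w₁) :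
    ∀ y ∈ T, i₀ ≤ y → y ∉ V₁ := by
  classical
  have hmem : ∀ t, t ∈ T ∨ t = b → t ≠ i₀ → t ∈ V₂ := by
    rintro t (h | rfl) hne
    · exact hother t h hne
    · exact hb₂
  have hmem' : ∀ t, t ∈ T ∨ t = a → t ≠ i₀ → t ∈ V₂ := by
    rintro t (h | rfl) hne
    · exact hother t h hne
    · exact ha₂
  have hlb : ∀ t, t ∈ T ∨ t = b → t ∈ Z ∧ b ≤ t := by
    rintro t (h | rfl)
    · exact ⟨(D.T_sub t h).1, (D.T_sub t h).2.1.le⟩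
    · exact ⟨D.hb, le_rfl⟩
  have hub : ∀ t, t ∈ T ∨ t = a → t ∈ Z ∧ t ≤ a := by
    rintro t (h | rfl)
    · exact ⟨(D.T_sub t h).1, (D.T_sub t h).2.2.le⟩
    · exact ⟨D.ha, le_rfl⟩
  have key : ∀ z ∈ T, i₀ ≤ z → ∀ V ∈ F, ∀ l r w, Wit b a Z T V l z r w → w₁ ∉ V := by
    by_contra! hcon
    obtain ⟨z0, hz0, hiz0, V0, hV0, l0, r0, w0, hwit0, hwV0⟩ := hcon
    have hne : (T.filter fun z => i₀ ≤ z ∧ ∃ V ∈ F, ∃ l r w, Wit b a Z T V l z r w ∧ w₁ ∈ V).Nonempty :=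
      ⟨z0, Finset.mem_filter.2 ⟨hz0, hiz0, V0, hV0, l0, r0, w0, hwit0, hwV0⟩⟩
    obtain ⟨z, hzS, hmin⟩ := Finset.exists_min_image _ id hne
    obtain ⟨hz, hiz, V, hV, l, r, w, hwit, hwV⟩ := Finset.mem_filter.1 hzS
    obtain ⟨k1, k2, k3, k4, k5, k6, k7, k8, k9, k10⟩ := hwit
    have hlb' := hlb l k3
    have hub' := hub r k4
    have hzb := D.T_sub z hz
    rcases hiz.eq_or_lt with rfl | hlt
    · exact (D.pair V hV V₂ hV₂).cyc (p := i₀) (q := r) (r := w₁) (s := l) (by grind)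
        k5 hi₀' (hmem' r k4 k2.ne') k7 hwV hw₁' (hmem l k3 k1.ne) k6
    · obtain ⟨z', hz', hiz', hd⟩ := hdown z hz hlt
      obtain ⟨V', hV', l0, z1, w0', hw'⟩ := hc z' hz'
      have hwV' : w₁ ∉ V' := by
        intro hwV'
        exact absurd (hmin z' (Finset.mem_filter.2 ⟨hz', hiz', V', hV', l0, z1, w0', hw', hwV'⟩))
          (not_le.2 hd.1)
      obtain rfl := hd.2 V' hV' _ _ _ hw'
      obtain ⟨hzz, hD⟩ := hd
      obtain ⟨l1, -, l3, l4, l5, l6, l7, l8, l9, l10⟩ := hw'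
      have hzb' := D.T_sub z' hz'
      have hlb0 := hlb l0 l3
      obtain ⟨r', hr1, hr2, hr3, hr4⟩ : ∃ r', r' ∈ V' ∧ r' ∉ V ∧ z1 < r' ∧ r' ≤ a := by
        by_cases hrV : r ∈ V'
        · exact ⟨r, hrV, k7, k2, hub'.2⟩
        · have hws : z1 < w0' ∧ w0' < r := by
            by_contra hcon
            have := hD V' hV' l0 r w0' ⟨l1, hzz.trans k2, l3, k4, l5, l6, hrV, l8, l9, by grind⟩
            exact absurd this k2.ne'
          refine ⟨w0', l8, fun hw0V => ?_, hws.1, (hws.2.trans_le hub'.2).le⟩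
          exact (D.sepZ V hV).symm.cyc (p := l) (q := w0') (r := r) (s := w) (by grind)
            hlb'.1 k6 hw0V l9 hub'.1 k7 k8 k9
      obtain ⟨l', hl1, hl2, hl3, hl4⟩ : ∃ l', l' ∈ V' ∧ l' ∉ V ∧ l' < z1 ∧ b ≤ l' := by
        by_cases hlz : z' ≤ l
        · refine ⟨l, ?_, k6, k1, hlb'.2⟩
          by_contra hlV
          have hlne : z' ≠ l := by rintro rfl; exact hlV l5
          have hlT : l ∈ T := by
            rcases k3 with h | rfl
            · exact h
            · exact absurd hzb'.2.1 (not_lt.2 hlz)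
          have := hD V' hV' l0 l w0' ⟨l1, lt_of_le_of_ne hlz hlne, l3, Or.inl hlT, l5, l6, hlV,
            l8, l9, by grind⟩
          exact absurd this k1.ne
        · refine ⟨z', l5, fun hzV => ?_, hzz, hzb'.2.1.le⟩
          have := hD V hV l r w ⟨not_le.1 hlz, hzz.trans k2, k3, k4, hzV, k6, k7, k8, k9, k10⟩
          exact absurd this k2.ne'
      exact (D.pair V' hV' V hV).cyc (p := l') (q := z1) (r := r') (s := w₁) (by grind)
        hl1 hl2 k5 l7 hr1 hr2 hwV hwV'
  by_contra! hcon
  obtain ⟨y0, hy0, hiy0, hyV0⟩ := hcon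
  have hne : (T.filter fun z => i₀ ≤ z ∧ z ∈ V₁).Nonempty :=
    ⟨y0, Finset.mem_filter.2 ⟨hy0, hiy0, hyV0⟩⟩
  obtain ⟨y, hyS, hmin⟩ := Finset.exists_min_image _ id hne
  obtain ⟨hy, hiy, hyV⟩ := Finset.mem_filter.1 hyS
  have hlt : i₀ < y := lt_of_le_of_ne hiy (by rintro rfl; exact hsub hyV)
  obtain ⟨z, hz, hiz, hd⟩ := hdown y hy hlt
  have hzV₁ : z ∉ V₁ := fun h =>
    absurd (hmin z (Finset.mem_filter.2 ⟨hz, hiz, h⟩)) (not_le.2 hd.1)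
  obtain ⟨V, hV, l, y1, w, hwit⟩ := hc z hz
  have hw₁V := key z hz hiz V hV _ _ _ hwit
  obtain rfl := hd.2 V hV _ _ _ hwit
  obtain ⟨k1, k2, k3, k4, k5, k6, k7, k8, k9, k10⟩ := hwit
  have hlb' := hlb l k3
  have hzb := D.T_sub z hz
  have hyb := D.T_sub _ hy
  obtain ⟨w'', hw1, hw2, hw3⟩ := hst
  obtain ⟨r', hr1, hr2, hr3, hr4⟩ : ∃ r', r' ∈ V ∧ r' ∉ V₁ ∧ y1 < r' ∧ r' ≤ a := by
    by_cases haV : a ∈ V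
    · exact ⟨a, haV, ha₁, hyb.2.2, le_rfl⟩
    · have hws : y1 < w ∧ w < a := by
        by_contra hcon
        have hwa : w ≠ a := by rintro rfl; exact k9 D.ha
        have := hd.2 V hV l a w ⟨k1, hzb.2.2, k3, Or.inr rfl, k5, k6, haV, k8, k9, by grind⟩
        exact absurd this hyb.2.2.ne'
      refine ⟨w, k8, fun hwV => ?_, hws.1, hws.2.le⟩
      exact (D.sepZ V₁ hV₁).symm.cyc (p := b) (q := w) (r := a) (s := w'') (by grind)
        D.hb hb₁ hwV k9 D.ha ha₁ hw1 hw2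
  exact (D.pair V hV V₁ hV₁).cyc (p := z) (q := y1) (r := r') (s := w₁) (by grind)
    k5 hzV₁ hyV k7 hr1 hr2 hw₁ hw₁V

theorem exists_not_cov_of_dominated {b a : α} {Z V₂ : Set α} {F : Set (Set α)} {T : Finset α}
    (D : CovData b a Z F T) (hV₂ : V₂ ∈ F) (hb₂ : b ∈ V₂) (ha₂ : a ∈ V₂)
    (hdom : ∀ V ∈ F, b ∉ V → a ∉ V → (∃ w ∈ V, w ∉ Z ∧ (w < b ∨ a < w)) →
      (∀ t ∈ T, t ∉ V₂ → t ∉ V) ∧ ∃ w ∈ V, w ∉ V₂ ∧ (w < b ∨ a < w))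
    (hT : ∃ t ∈ T, t ∉ V₂) :
    ∃ y ∈ T, ¬ Cov b a Z F T y := by
  classical
  induction T using Finset.strongInduction with
  | H T ih =>
    by_contra! hc
    obtain ⟨i₀, hi₀, hi₀'⟩ := hT
    have hdel0 : ∀ i ∈ T, (∃ t ∈ T, t ≠ i ∧ t ∉ V₂) →
        ∃ y ∈ T, Up b a Z F T i y ∨ Down b a Z F T i y := by
      rintro i hi ⟨t, ht, hti, htV⟩
      obtain ⟨y, hy, hn⟩ := ih _ (Finset.erase_ssubset hi)
        (D.mono subset_rfl (Finset.erase_subset _ _))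
        (fun V hV h1 h2 h3 => ⟨fun t ht => (hdom V hV h1 h2 h3).1 t (Finset.mem_of_mem_erase ht),
          (hdom V hV h1 h2 h3).2⟩) ⟨t, Finset.mem_erase.2 ⟨hti, ht⟩, htV⟩
      exact ⟨y, Finset.mem_of_mem_erase hy, up_or_down_of_erase hy hn⟩
    by_cases hother : ∃ t ∈ T, t ≠ i₀ ∧ t ∉ V₂
    · refine not_all_deletable D ⟨i₀, hi₀⟩ hc fun i hi => hdel0 i hi ?_
      by_cases h : i = i₀
      · rw [h]; exact hother
      · exact ⟨i₀, hi₀, fun h' => h h'.symm, hi₀'⟩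
    · push Not at hother
      have hdel : ∀ i ∈ T, i ≠ i₀ → ∃ y ∈ T, Up b a Z F T i y ∨ Down b a Z F T i y :=
        fun i hi h => hdel0 i hi ⟨i₀, hi₀, fun h' => h h'.symm, hi₀'⟩
      have hnoup : ∀ i ∈ T, i₀ < i → ∀ y ∈ T, ¬ Up b a Z F T i y := by
        by_contra! hcon
        obtain ⟨i, hi, hlt, y, hy, hu⟩ := hcon
        have hS : (T.filter fun i => i₀ < i ∧ ∃ y ∈ T, Up b a Z F T i y).Nonempty :=
          ⟨i, Finset.mem_filter.2 ⟨hi, hlt, y, hy, hu⟩⟩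
        obtain ⟨hi, hlt, y, hy, hu⟩ := Finset.mem_filter.1 (Finset.max'_mem _ hS)
        obtain ⟨z, hz, h | h⟩ := hdel y hy (hlt.trans hu.1).ne'
        · exact absurd hu.1 (not_lt.2 (Finset.le_max' _ _
            (Finset.mem_filter.2 ⟨hy, hlt.trans hu.1, z, hz, h⟩)))
        · exact up_down_false D hc hi hy hz hu h
      have hnodown : ∀ i ∈ T, i < i₀ → ∀ y ∈ T, ¬ Down b a Z F T i y := by
        by_contra! hcon
        obtain ⟨i, hi, hlt, y, hy, hu⟩ := hcon
        have hS : (T.filter fun i => i < i₀ ∧ ∃ y ∈ T, Down b a Z F T i y).Nonempty :=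
          ⟨i, Finset.mem_filter.2 ⟨hi, hlt, y, hy, hu⟩⟩
        obtain ⟨hi, hlt, y, hy, hu⟩ := Finset.mem_filter.1 (Finset.min'_mem _ hS)
        obtain ⟨z, hz, h | h⟩ := hdel y hy (hu.1.trans hlt).ne
        · exact down_up_false D hc hi hy hz hu h
        · exact absurd hu.1 (not_lt.2 (Finset.min'_le _ _
            (Finset.mem_filter.2 ⟨hy, hu.1.trans hlt, z, hz, h⟩)))
      have hdown : ∀ i ∈ T, i₀ < i → ∃ z ∈ T, i₀ ≤ z ∧ Down b a Z F T i z := by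
        intro i hi hlt
        obtain ⟨z, hz, h | h⟩ := hdel i hi hlt.ne'
        · exact absurd h (hnoup i hi hlt z hz)
        · refine ⟨z, hz, ?_, h⟩
          by_contra hzi
          obtain ⟨z', hz', h' | h'⟩ := hdel z hz (not_le.1 hzi).ne
          · exact down_up_false D hc hi hz hz' h h'
          · exact hnodown z hz (not_le.1 hzi) z' hz' h'
      have hup : ∀ i ∈ T, i < i₀ → ∃ z ∈ T, z ≤ i₀ ∧ Up b a Z F T i z := by
        intro i hi hlt
        obtain ⟨z, hz, h | h⟩ := hdel i hi hlt.ne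
        · refine ⟨z, hz, ?_, h⟩
          by_contra hzi
          obtain ⟨z', hz', h' | h'⟩ := hdel z hz (not_le.1 hzi).ne'
          · exact hnoup z hz (not_le.1 hzi) z' hz' h'
          · exact up_down_false D hc hi hz hz' h h'
        · exact absurd h (hnodown i hi hlt z hz)
      have havoid : ∀ V ∈ F, b ∉ V → a ∉ V → (∃ w ∈ V, w ∉ Z ∧ (w < b ∨ a < w)) →
          ∀ y ∈ T, y ∉ V := by
        intro V hV h1 h2 h3 y hy
        obtain ⟨hs, w₁, hw1, hw2, hw3⟩ := hdom V hV h1 h2 h3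
        rcases le_total i₀ y with h | h
        · exact straddle_avoids_up D hV₂ hb₂ ha₂ hi₀' hother hc hdown hV h1 h2 h3
            (hs i₀ hi₀ hi₀') hw1 hw2 hw3 y hy h
        · obtain ⟨w, hw, hw', hw''⟩ := h3
          exact straddle_avoids_up D.dual hV₂ ha₂ hb₂ hi₀' hother
            (fun y hy => Cov.dual.2 (hc y hy))
            (fun i hi hlt => by
              obtain ⟨z, hz, hzi, hu⟩ := hup i hi hlt
              exact ⟨z, hz, hzi, Down.dual.2 hu⟩) hV h2 h1 ⟨w, hw, hw', hw''.symm⟩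
            (hs i₀ hi₀ hi₀') hw1 hw2 hw3.symm y hy h
      obtain ⟨y, hy, hn⟩ := exists_not_cov_of_no_straddle
        (F := {V ∈ F | ¬ (b ∉ V ∧ a ∉ V ∧ ∃ w ∈ V, w ∉ Z ∧ (w < b ∨ a < w))})
        (D.mono (fun _ h => h.1) subset_rfl) ⟨i₀, hi₀⟩
        (fun V hV h1 h2 w hw hw' h3 => hV.2 ⟨h1, h2, w, hw, hw', h3⟩)
      obtain ⟨V, hV, i, j, w, hw⟩ := hc y hy
      refine hn ⟨V, ⟨hV, fun h => havoid V hV h.1 h.2.1 h.2.2 y hy hw.2.2.2.2.1⟩, i, j, w, hw⟩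

end Coverage2

section Erase

variable {α : Type*} [LinearOrder α]

def Cyc4 (p q r s : α) : Prop :=
  p < q ∧ q < r ∧ r < s ∨ q < r ∧ r < s ∧ s < p ∨ r < s ∧ s < p ∧ p < q ∨ s < p ∧ p < q ∧ q < r

theorem exists_cyc_of_not_altFree {V Z : Set α} {y : α} (h : ¬ AltFree V (Z \ {y}))
    (hZ : AltFree V Z) : y ∈ V ∧ ∃ d d' w, Cyc4 d y d' w ∧ d ∈ Z ∧ d ∉ V ∧ d' ∈ Z ∧ d' ∉ V ∧
      w ∈ V ∧ w ∉ Z := by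
  have aux : ∀ p q r s, Cyc4 p q r s → p ∈ Z \ {y} → p ∉ V → q ∈ V → q ∉ Z \ {y} →
      r ∈ Z \ {y} → r ∉ V → s ∈ V → s ∉ Z \ {y} → y ∈ V ∧ ∃ d d' w, Cyc4 d y d' w ∧ d ∈ Z ∧
        d ∉ V ∧ d' ∈ Z ∧ d' ∉ V ∧ w ∈ V ∧ w ∉ Z := by
    intro p q r s hc hp hp' hq hq' hr hr' hs hs'
    simp only [Set.mem_sdiff, Set.mem_singleton_iff, not_and, not_not] at hp hq' hr hs'
    by_cases hqy : q = y
    · subst hqy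
      refine ⟨hq, p, r, s, hc, hp.1, hp', hr.1, hr', hs, fun h => ?_⟩
      have := hs' h
      unfold Cyc4 at hc
      grind
    · by_cases hsy : s = y
      · subst hsy
        refine ⟨hs, r, p, q, ?_, hr.1, hr', hp.1, hp', hq, fun h => hqy (hq' h)⟩
        unfold Cyc4 at *
        grind
      · exact (hZ.symm.cyc hc hp.1 hp' hq (fun h => hqy (hq' h)) hr.1 hr' hs
          (fun h => hsy (hs' h))).elim
  unfold AltFree at h
  push Not at h
  obtain ⟨p, q, r, s, h1, h2, h3, h4⟩ := h
  by_cases h5 : p ∈ V ∧ p ∉ Z \ {y} ∧ q ∈ Z \ {y} ∧ q ∉ V ∧ r ∈ V ∧ r ∉ Z \ {y} ∧ s ∈ Z \ {y} ∧ s ∉ V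
  · obtain ⟨k1, k2, k3, k4, k5, k6, k7, k8⟩ := h5
    exact aux q r s p (Or.inr (Or.inr (Or.inr ⟨h1, h2, h3⟩))) k3 k4 k5 k6 k7 k8 k1 k2
  · have h5' := h4 (by tauto)
    obtain ⟨k1, k2, k3, k4, k5, k6, k7, k8⟩ := h5'
    exact aux p q r s (Or.inl ⟨h1, h2, h3⟩) k1 k2 k3 k4 k5 k6 k7 k8

theorem cov_of_not_altFree {b a y : α} {Z V : Set α} {F : Set (Set α)} {Y : Finset α}
    (hY : ∀ t, t ∈ Y ↔ t ∈ Z ∧ b < t ∧ t < a) (hb : b ∈ Z) (ha : a ∈ Z)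
    (hV : V ∈ F) (hZ : AltFree V Z) (hZb : AltFree V (Z \ {b})) (hZa : AltFree V (Z \ {a}))
    (hy : y ∈ Y) (h : ¬ AltFree V (Z \ {y})) : Cov b a Z F Y y := by
  obtain ⟨hyV, d, d', w, hc, h1, h2, h3, h4, h5, h6⟩ := exists_cyc_of_not_altFree h hZ
  obtain ⟨hyZ, hby, hya⟩ := (hY y).1 hy
  have hwa : w ≠ a := by rintro rfl; exact h6 ha
  have hwb : w ≠ b := by rintro rfl; exact h6 hb
  have hda : ¬ (y < d' ∧ d' ≤ a) → a ∉ V := by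
    intro hn haV
    have h7 : d' ≠ a := by rintro rfl; exact h4 haV
    have h8 : d ≠ a := by rintro rfl; exact h2 haV
    refine hZa.cyc (p := a) (q := d') (r := w) (s := d) ?_ haV (by simp) ⟨h3, h7⟩ h4 h5
      (fun h => h6 h.1) ⟨h1, h8⟩ h2
    unfold Cyc4 at hc
    grind
  have hdb : ¬ (b ≤ d ∧ d < y) → b ∉ V := by
    intro hn haV
    have h7 : d' ≠ b := by rintro rfl; exact h4 haV
    have h8 : d ≠ b := by rintro rfl; exact h2 haV
    refine hZb.cyc (p := b) (q := d') (r := w) (s := d) ?_ haV (by simp) ⟨h3, h7⟩ h4 h5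
      (fun h => h6 h.1) ⟨h1, h8⟩ h2
    unfold Cyc4 at hc
    grind
  by_cases hA : y < d' ∧ d' ≤ a <;> by_cases hB : b ≤ d ∧ d < y
  · refine ⟨V, hV, d, d', w, hB.2, hA.1, ?_, ?_, hyV, h2, h4, h5, h6, ?_⟩
    · rcases hB.1.eq_or_lt with h | h
      · exact Or.inr h.symm
      · exact Or.inl ((hY d).2 ⟨h1, h, hB.2.trans hya⟩)
    · rcases hA.2.eq_or_lt with h | h
      · exact Or.inr h
      · exact Or.inl ((hY d').2 ⟨h3, hby.trans hA.1, h⟩)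
    · unfold Cyc4 at hc; grind
  · refine ⟨V, hV, b, d', w, hby, hA.1, Or.inr rfl, ?_, hyV, hdb hB, h4, h5, h6, ?_⟩
    · rcases hA.2.eq_or_lt with h | h
      · exact Or.inr h
      · exact Or.inl ((hY d').2 ⟨h3, hby.trans hA.1, h⟩)
    · unfold Cyc4 at hc; grind
  · refine ⟨V, hV, d, a, w, hB.2, hya, ?_, Or.inr rfl, hyV, h2, hda hA, h5, h6, ?_⟩
    · rcases hB.1.eq_or_lt with h | h
      · exact Or.inr h.symm
      · exact Or.inl ((hY d).2 ⟨h1, h, hB.2.trans hya⟩)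
    · unfold Cyc4 at hc; grind
  · refine ⟨V, hV, b, a, w, hby, hya, Or.inr rfl, Or.inr rfl, hyV, hdb hB, hda hA, h5, h6, ?_⟩
    unfold Cyc4 at hc; grind

theorem exists_altFree_erase {b a : α} {Z : Set α} {F : Set (Set α)} (hfin : {t ∈ Z | b < t ∧ t < a}.Finite)
    (hb : b ∈ Z) (ha : a ∈ Z) (hpair : ∀ V ∈ F, ∀ W ∈ F, AltFree V W)
    (hZ : ∀ V ∈ F, AltFree V Z) (hZb : ∀ V ∈ F, AltFree V (Z \ {b}))
    (hZa : ∀ V ∈ F, AltFree V (Z \ {a}))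
    (h : ((∃ y ∈ Z, b < y ∧ y < a) ∧
        ∀ V ∈ F, b ∉ V → a ∉ V → ∀ w ∈ V, w ∉ Z → ¬ (w < b ∨ a < w)) ∨
      ∃ V₂ ∈ F, b ∈ V₂ ∧ a ∈ V₂ ∧ (∃ y ∈ Z, (b < y ∧ y < a) ∧ y ∉ V₂) ∧
        ∀ V ∈ F, b ∉ V → a ∉ V → (∃ w ∈ V, w ∉ Z ∧ (w < b ∨ a < w)) →
          (∀ t ∈ Z, b < t → t < a → t ∉ V₂ → t ∉ V) ∧ ∃ w ∈ V, w ∉ V₂ ∧ (w < b ∨ a < w)) :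
    ∃ y ∈ Z, (b < y ∧ y < a) ∧ ∀ V ∈ F, AltFree V (Z \ {y}) := by
  classical
  have hY : ∀ t, t ∈ hfin.toFinset ↔ t ∈ Z ∧ b < t ∧ t < a := by
    simp
    tauto
  generalize hfin.toFinset = Y at hY
  have D : CovData b a Z F Y := ⟨hb, ha, hpair, hZ, fun t ht => (hY t).1 ht⟩
  have hex : ∃ y ∈ Y, ¬ Cov b a Z F Y y := by
    rcases h with ⟨⟨y, h1, h2⟩, h3⟩ | ⟨V₂, h1, h2, h3, ⟨y, h4, h5, h6⟩, h7⟩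
    · exact exists_not_cov_of_no_straddle D ⟨y, (hY y).2 ⟨h1, h2⟩⟩ h3
    · refine exists_not_cov_of_dominated D h1 h2 h3 (fun V hV k1 k2 k3 => ?_) ⟨y, (hY y).2 ⟨h4, h5⟩, h6⟩
      obtain ⟨k4, k5⟩ := h7 V hV k1 k2 k3
      refine ⟨fun t ht => ?_, k5⟩
      obtain ⟨m1, m2, m3⟩ := (hY t).1 ht
      exact k4 t m1 m2 m3
  obtain ⟨y, hy, hn⟩ := hex
  obtain ⟨m1, m2⟩ := (hY y).1 hy
  refine ⟨y, m1, m2, fun V hV => ?_⟩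
  by_contra hcon
  exact hn (cov_of_not_altFree hY hb ha hV (hZ V hV) (hZb V hV) (hZa V hV) hy hcon)

end Erase

section Edge

theorem altFree_of_cyc {α : Type*} [LinearOrder α] {P Q : Set α}
    (h : ∀ p q r s, Cyc4 p q r s → p ∈ P → p ∉ Q → q ∈ Q → q ∉ P → r ∈ P → r ∉ Q → s ∈ Q →
      s ∉ P → False) : AltFree P Q := by
  intro p q r s h1 h2 h3
  constructor
  · rintro ⟨k1, k2, k3, k4, k5, k6, k7, k8⟩
    exact h p q r s (Or.inl ⟨h1, h2, h3⟩) k1 k2 k3 k4 k5 k6 k7 k8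
  · rintro ⟨k1, k2, k3, k4, k5, k6, k7, k8⟩
    exact h q r s p (Or.inr (Or.inr (Or.inr ⟨h1, h2, h3⟩))) k3 k4 k5 k6 k7 k8 k1 k2

/-- The linear order obtained by rotating so that `c` becomes the largest element. -/
@[reducible] def rotOrder {α : Type*} [LinearOrder α] (c : α) : LinearOrder α :=
  LinearOrder.lift' (fun x : α => toLex (decide (x ≤ c), x))
    (fun _ _ h => (Prod.ext_iff.1 (toLex.injective h)).2)

theorem rotOrder_lt {α : Type*} [LinearOrder α] (c x y : α) :
    (rotOrder c).lt x y ↔ (c < x ∧ y ≤ c) ∨ (c < x ∧ x < y) ∨ (y ≤ c ∧ x < y) := by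
  change toLex (decide (x ≤ c), x) < toLex (decide (y ≤ c), y) ↔ _
  rw [Prod.Lex.toLex_lt_toLex]
  by_cases h1 : x ≤ c <;> by_cases h2 : y ≤ c <;> simp [h1, h2, Bool.lt_iff] <;> grind

theorem cyc4_rotOrder {α : Type*} [LinearOrder α] (c p q r s : α) :
    @Cyc4 α (rotOrder c) p q r s ↔ Cyc4 p q r s := by
  have e : ∀ x y, (rotOrder c).lt x y ↔ _ := rotOrder_lt c
  unfold Cyc4
  change ((rotOrder c).lt p q ∧ (rotOrder c).lt q r ∧ (rotOrder c).lt r s ∨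
    (rotOrder c).lt q r ∧ (rotOrder c).lt r s ∧ (rotOrder c).lt s p ∨
    (rotOrder c).lt r s ∧ (rotOrder c).lt s p ∧ (rotOrder c).lt p q ∨
    (rotOrder c).lt s p ∧ (rotOrder c).lt p q ∧ (rotOrder c).lt q r) ↔ _
  generalize (rotOrder c).lt = R at e
  simp only [e]
  clear e
  rcases le_or_gt p c with hp | hp <;> rcases le_or_gt q c with hq | hq <;>
    rcases le_or_gt r c with hr | hr <;> rcases le_or_gt s c with hs | hs <;>
    simp only [hp, hq, hr, hs, not_le.2, not_lt.2, true_and, false_and, false_or, true_or,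
      or_false] <;>
    grind

theorem altFree_rotOrder {α : Type*} [LinearOrder α] (c : α) {P Q : Set α} :
    @AltFree α (rotOrder c) P Q ↔ AltFree P Q := by
  constructor
  · intro h
    refine altFree_of_cyc fun p q r s hc => ?_
    exact @AltFree.cyc α (rotOrder c) P Q h p q r s ((cyc4_rotOrder c p q r s).2 hc)
  · intro h
    refine @altFree_of_cyc α (rotOrder c) P Q fun p q r s hc => ?_
    exact h.cyc ((cyc4_rotOrder c p q r s).1 hc)

/-- Version of `exists_altFree_erase` for the outer path from `b` to `a`. -/
theorem exists_altFree_erase_outer {α : Type*} [LinearOrder α] {b a : α} {Z : Set α}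
    {F : Set (Set α)} (hab : a < b) (hfin : Z.Finite)
    (hb : b ∈ Z) (ha : a ∈ Z) (hpair : ∀ V ∈ F, ∀ W ∈ F, AltFree V W)
    (hZ : ∀ V ∈ F, AltFree V Z) (hZb : ∀ V ∈ F, AltFree V (Z \ {b}))
    (hZa : ∀ V ∈ F, AltFree V (Z \ {a}))
    (h : ((∃ y ∈ Z, (y < a ∨ b < y)) ∧
        ∀ V ∈ F, b ∉ V → a ∉ V → ∀ w ∈ V, w ∉ Z → ¬ (a < w ∧ w < b)) ∨
      ∃ V₂ ∈ F, b ∈ V₂ ∧ a ∈ V₂ ∧ (∃ y ∈ Z, (y < a ∨ b < y) ∧ y ∉ V₂) ∧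
        ∀ V ∈ F, b ∉ V → a ∉ V → (∃ w ∈ V, w ∉ Z ∧ (a < w ∧ w < b)) →
          (∀ t ∈ Z, (t < a ∨ b < t) → t ∉ V₂ → t ∉ V) ∧ ∃ w ∈ V, w ∉ V₂ ∧ (a < w ∧ w < b)) :
    ∃ y ∈ Z, (y < a ∨ b < y) ∧ ∀ V ∈ F, AltFree V (Z \ {y}) := by
  have e1 : ∀ t, ((rotOrder a).lt b t ∧ (rotOrder a).lt t a) ↔ (t < a ∨ b < t) := by
    intro t; simp only [rotOrder_lt]; grind
  have e2 : ∀ t, ((rotOrder a).lt t b ∨ (rotOrder a).lt a t) ↔ (a < t ∧ t < b) := by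
    intro t; simp only [rotOrder_lt]; grind
  have := @exists_altFree_erase α (rotOrder a) b a Z F (hfin.subset fun _ h => h.1) hb ha
    (fun V hV W hW => (altFree_rotOrder a).2 (hpair V hV W hW))
    (fun V hV => (altFree_rotOrder a).2 (hZ V hV))
    (fun V hV => (altFree_rotOrder a).2 (hZb V hV))
    (fun V hV => (altFree_rotOrder a).2 (hZa V hV)) (by
      rcases h with ⟨⟨y, h1, h2⟩, h3⟩ | ⟨V₂, h1, h2, h3, ⟨y, h4, h5, h6⟩, h7⟩
      · exact Or.inl ⟨⟨y, h1, (e1 y).2 h2⟩, fun V hV k1 k2 w k3 k4 k5 =>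
          h3 V hV k1 k2 w k3 k4 ((e2 w).1 k5)⟩
      · refine Or.inr ⟨V₂, h1, h2, h3, ⟨y, h4, (e1 y).2 h5, h6⟩, fun V hV k1 k2 k3 => ?_⟩
        obtain ⟨w, k3, k4, k5⟩ := k3
        obtain ⟨m1, w', m2, m3, m4⟩ := h7 V hV k1 k2 ⟨w, k3, k4, (e2 w).1 k5⟩
        exact ⟨fun t ht q1 q2 => m1 t ht ((e1 t).1 ⟨q1, q2⟩), w', m2, m3, (e2 w').2 m4⟩)
  obtain ⟨y, h1, h2, h3⟩ := this
  exact ⟨y, h1, (e1 y).1 h2, fun V hV => (altFree_rotOrder a).1 (h3 V hV)⟩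

/-- Version of `exists_altFree_erase` for complements, along the inner path from `a` to `b`. -/
theorem exists_altFree_insert_inner {b a : ℕ} {K : Set ℕ}
    {F : Set (Set ℕ)}
    (hb : b ∉ K) (ha : a ∉ K) (hpair : ∀ V ∈ F, ∀ W ∈ F, AltFree V W)
    (hK : ∀ V ∈ F, AltFree V K) (hKb : ∀ V ∈ F, AltFree V (insert b K))
    (hKa : ∀ V ∈ F, AltFree V (insert a K))
    (h : ((∃ x, x ∉ K ∧ a < x ∧ x < b) ∧
        ∀ V ∈ F, b ∈ V → a ∈ V → ∀ w ∈ K, w ∉ V → ¬ (w < a ∨ b < w)) ∨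
      ∃ V₁ ∈ F, b ∉ V₁ ∧ a ∉ V₁ ∧ (∃ x, x ∉ K ∧ (a < x ∧ x < b) ∧ x ∈ V₁) ∧
        ∀ V ∈ F, b ∈ V → a ∈ V → (∃ w ∈ K, w ∉ V ∧ (w < a ∨ b < w)) →
          (∀ t ∉ K, a < t → t < b → t ∈ V₁ → t ∈ V) ∧ ∃ w ∈ V₁, w ∉ V ∧ (w < a ∨ b < w)) :
    ∃ x, x ∉ K ∧ (a < x ∧ x < b) ∧ ∀ V ∈ F, AltFree V (insert x K) := by
  have hins : ∀ x, Kᶜ \ {x} = (insert x K)ᶜ := by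
    intro x; ext t; simp [not_or, and_comm]
  have := exists_altFree_erase (α := ℕ) (b := a) (a := b) (Z := Kᶜ) (F := {S | Sᶜ ∈ F})
    ((Set.finite_lt_nat b).subset fun _ h => h.2.2) ha hb
    (fun V hV W hW => by simpa using (hpair _ hV _ hW).compl)
    (fun V hV => by simpa using (hK _ hV).compl)
    (fun V hV => by rw [hins]; simpa using (hKa _ hV).compl)
    (fun V hV => by rw [hins]; simpa using (hKb _ hV).compl)
    (by
      rcases h with ⟨⟨y, h1, h2⟩, h3⟩ | ⟨V₂, h1, h2, h3, ⟨y, h4, h5, h6⟩, h7⟩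
      · exact Or.inl ⟨⟨y, h1, h2⟩, fun V hV k1 k2 w k3 k4 k5 =>
          h3 Vᶜ hV k2 k1 w (by simpa using k4) (by simpa using k3) k5⟩
      · refine Or.inr ⟨V₂ᶜ, by simpa using h1, h3, h2, ⟨y, h4, h5, by simpa using h6⟩,
          fun V hV k1 k2 k3 => ?_⟩
        obtain ⟨w, k3, k4, k5⟩ := k3
        obtain ⟨m1, w', m2, m3, m4⟩ := h7 Vᶜ hV k2 k1 ⟨w, by simpa using k4, by simpa using k3, k5⟩
        exact ⟨fun t ht q1 q2 q3 => m1 t ht q1 q2 (by simpa using q3), w', by simpa using m3,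
          by simpa using m2, m4⟩)
  obtain ⟨x, h1, h2, h3⟩ := this
  refine ⟨x, h1, h2, fun V hV => ?_⟩
  have := (h3 Vᶜ (by simpa using hV)).compl
  rw [hins] at this
  simpa using this

end Edge

section EdgeLemma

theorem Cyc4.insert_point {p q r s k : ℕ} (h : Cyc4 p q r s) (hp : k ≠ p) (hr : k ≠ r) :
    Cyc4 p q r k ∨ Cyc4 p k r s := by
  unfold Cyc4 at *
  rcases lt_or_gt_of_ne hp with hp | hp <;> rcases lt_or_gt_of_ne hr with hr | hr <;>
    rcases h with h | h | h | h <;> simp only [hp, hr, hp.not_gt, hr.not_gt, h, true_and, and_true,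
      false_and, and_false, or_false, false_or, true_or, or_true]

theorem Cyc4.rot {p q r s : ℕ} (h : Cyc4 p q r s) : Cyc4 q r s p := by
  unfold Cyc4 at *
  tauto

theorem Cyc4.ne {p q r s : ℕ} (h : Cyc4 p q r s) : p ≠ r ∧ q ≠ s := by
  unfold Cyc4 at h
  rcases h with h | h | h | h <;> omega

theorem cyc4_or_of_inner_outer {a b p p' r r' : ℕ} (hp : a < p ∧ p < b) (hp' : a < p' ∧ p' < b)
    (hr : r < a ∨ b < r) (hr' : r' < a ∨ b < r') (h : p ≠ p') (h' : r ≠ r') :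
    (Cyc4 p p' r' r ∨ Cyc4 p r r' p') ∨ Cyc4 p p' r r' ∨ Cyc4 p r' r p' := by
  have h1 : r < p ∧ r < p' ∨ p < r ∧ p' < r := by omega
  have h2 : r' < p ∧ r' < p' ∨ p < r' ∧ p' < r' := by omega
  unfold Cyc4
  rcases lt_or_gt_of_ne h with h | h <;> rcases lt_or_gt_of_ne h' with h' | h' <;>
    rcases h1 with h1 | h1 <;> rcases h2 with h2 | h2 <;>
    simp only [h, h', h.not_gt, h'.not_gt, h1, h2, and_true, h1.1.not_gt, h1.2.not_gt,
      h2.1.not_gt, h2.2.not_gt, and_false, or_false, or_true,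
      and_self]

/-- Some column is dominated by all rows, or some row dominates no column. -/
theorem exists_full_or_empty {β : Type*} [DecidableEq β] (I J : Finset β) (hJ : J.Nonempty)
    (dom : β → β → Prop)
    (h : ∀ u ∈ I, ∀ u' ∈ I, ∀ v ∈ J, ∀ v' ∈ J, dom u v → ¬ dom u' v → dom u' v' → ¬ dom u v' → False) :
    (∃ v ∈ J, ∀ u ∈ I, dom u v) ∨ ∃ u ∈ I, ∀ v ∈ J, ¬ dom u v := by
  classical
  obtain ⟨v, hv, hmax⟩ := Finset.exists_max_image J (fun v => #{u ∈ I | dom u v}) hJ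
  by_contra! hcon
  obtain ⟨h1, h2⟩ := hcon
  obtain ⟨u', hu', hn⟩ := h1 v hv
  obtain ⟨v', hv', hd⟩ := h2 u' hu'
  refine absurd (hmax v' hv') (not_le.2 (Finset.card_lt_card ?_))
  rw [Finset.ssubset_iff_of_subset]
  · exact ⟨u', Finset.mem_filter.2 ⟨hu', hd⟩, fun h => hn (Finset.mem_filter.1 h).2⟩
  · intro u hu
    obtain ⟨hu, hd'⟩ := Finset.mem_filter.1 hu
    refine Finset.mem_filter.2 ⟨hu, ?_⟩
    by_contra h5
    exact h u hu u' hu' v hv v' hv' hd' hn hd h5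

theorem altFree_insert_insert {a b : ℕ} {K V : Finset ℕ}
    (hcard : #V = #K + 1) (h1 : AltFree (V : Set ℕ) (insert a K : Finset ℕ))
    (h2 : AltFree (V : Set ℕ) (insert b K : Finset ℕ)) :
    AltFree (V : Set ℕ) (insert a (insert b K) : Finset ℕ) := by
  refine altFree_of_cyc fun p q r s hc hp hp' hq hq' hr hr' hs hs' => ?_
  simp only [Finset.mem_coe, Finset.mem_insert, not_or] at *
  have hpr : p ≠ r := hc.ne.1
  have c1 : ∀ q' s', Cyc4 p q' r s' → q' ∉ V → s' ∉ V → ¬ ((q' = a ∨ q' ∈ K) ∧ (s' = a ∨ s' ∈ K)) := by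
    intro q' s' hc' k1 k2 k3
    exact h1.cyc hc' hp (by simp; grind) (by simpa using k3.1) k1 hr (by simp; grind)
      (by simpa using k3.2) k2
  have c2 : ∀ q' s', Cyc4 p q' r s' → q' ∉ V → s' ∉ V → ¬ ((q' = b ∨ q' ∈ K) ∧ (s' = b ∨ s' ∈ K)) := by
    intro q' s' hc' k1 k2 k3
    exact h2.cyc hc' hp (by simp; grind) (by simpa using k3.1) k1 hr (by simp; grind)
      (by simpa using k3.2) k2
  have e1 := c1 q s hc hq' hs'
  have e2 := c2 q s hc hq' hs'
  have hKV : ∀ k ∈ K, k ∈ V := by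
    intro k hk
    by_contra hkV
    have hkp : k ≠ p := by rintro rfl; exact hkV hp
    have hkr : k ≠ r := by rintro rfl; exact hkV hr
    have := hc.insert_point hkp hkr
    rcases this with h | h
    · have e3 := c1 q k h hq' hkV
      have e4 := c2 q k h hq' hkV
      grind
    · have e3 := c1 k s h hkV hs'
      have e4 := c2 k s h hkV hs'
      grind
  have : insert p (insert r K) ⊆ V := by
    intro x hx
    simp only [Finset.mem_insert] at hx
    rcases hx with rfl | rfl | hx
    · exact hp
    · exact hr
    · exact hKV x hx
  have := Finset.card_le_card this
  rw [Finset.card_insert_of_notMem (by simp; grind), Finset.card_insert_of_notMem (by grind)] at this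
  omega

theorem altFree_of_insert {a b : ℕ} (hab : a ≠ b) {K V : Finset ℕ}
    (hcard : #V = #K + 1) (h1 : AltFree (V : Set ℕ) (insert a K : Finset ℕ))
    (h2 : AltFree (V : Set ℕ) (insert b K : Finset ℕ)) :
    AltFree (V : Set ℕ) K := by
  refine altFree_of_cyc fun p q r s hc hp hp' hq hq' hr hr' hs hs' => ?_
  simp only [Finset.mem_coe] at *
  have hqs : q ≠ s := hc.ne.2
  have c1 : ∀ p' r', Cyc4 p' q r' s → p' ∈ V → r' ∈ V → ¬ ((p' ≠ a ∧ p' ∉ K) ∧ (r' ≠ a ∧ r' ∉ K)) := by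
    intro q' s' hc' k1 k2 k3
    exact h1.cyc hc' k1 (by simp; grind) (by simp; grind) hq' k2 (by simp; grind)
      (by simp; grind) hs'
  have c2 : ∀ p' r', Cyc4 p' q r' s → p' ∈ V → r' ∈ V → ¬ ((p' ≠ b ∧ p' ∉ K) ∧ (r' ≠ b ∧ r' ∉ K)) := by
    intro q' s' hc' k1 k2 k3
    exact h2.cyc hc' k1 (by simp; grind) (by simp; grind) hq' k2 (by simp; grind)
      (by simp; grind) hs'
  have e1 := c1 p r hc hp hr
  have e2 := c2 p r hc hp hr
  have hKV : ∀ k ∈ V, k ∉ K → k = a ∨ k = b := by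
    intro k hk hkK
    by_contra hkab
    have hkq : k ≠ q := by rintro rfl; exact hkK hq
    have hks : k ≠ s := by rintro rfl; exact hkK hs
    have : Cyc4 p q k s ∨ Cyc4 k q r s := hc.rot.insert_point hkq hks |>.elim (fun h => Or.inr h.rot.rot.rot) (fun h => Or.inl h.rot.rot.rot)
    rcases this with h | h
    · have e3 := c1 p k h hp hk
      have e4 := c2 p k h hp hk
      grind
    · have e3 := c1 k r h hk hr
      have e4 := c2 k r h hk hr
      grind
  have : V ⊆ insert a (insert b ((K.erase q).erase s)) := by
    intro x hx
    simp only [Finset.mem_insert, Finset.mem_erase]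
    by_cases hxK : x ∈ K
    · refine Or.inr (Or.inr ⟨?_, ?_, hxK⟩)
      · rintro rfl; exact hs' hx
      · rintro rfl; exact hq' hx
    · have := hKV x hx hxK
      grind
  have := Finset.card_le_card this
  have k1 := Finset.card_insert_le a (insert b ((K.erase q).erase s))
  have k2 := Finset.card_insert_le b ((K.erase q).erase s)
  have k3 := Finset.card_erase_add_one (s := K.erase q) (a := s) (by simp; grind)
  have k4 := Finset.card_erase_add_one hq
  omega

set_option maxHeartbeats 1000000 in
/-- The exchange lemma around an edge of a family of pairwise alternation-free sets. -/
theorem exists_edge_exchange {a b : ℕ} (hab : a < b) {K : Finset ℕ} (ha : a ∉ K) (hb : b ∉ K)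
    {F : Finset (Finset ℕ)} (hcard : ∀ V ∈ F, #V = #K + 1)
    (hpair : ∀ V ∈ F, ∀ W ∈ F, AltFree (V : Set ℕ) W)
    (haF : insert a K ∈ F) (hbF : insert b K ∈ F)
    (hne : (∃ x, x ∉ K ∧ a < x ∧ x < b) ∨ ∃ y ∈ K, y < a ∨ b < y) :
    (∃ x, x ∉ K ∧ (a < x ∧ x < b) ∧ ∀ V ∈ F, AltFree (V : Set ℕ) (insert x K : Finset ℕ)) ∨
    ∃ y ∈ K, (y < a ∨ b < y) ∧
      ∀ V ∈ F, AltFree (V : Set ℕ) ((insert a (insert b K)).erase y : Finset ℕ) := by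
  classical
  set Z := insert a (insert b K) with hZdef
  have hZb : Z \ {b} = insert a K := by
    ext t; simp only [hZdef, Finset.mem_sdiff, Finset.mem_insert, Finset.mem_singleton]; grind
  have hZa : Z \ {a} = insert b K := by
    ext t; simp only [hZdef, Finset.mem_sdiff, Finset.mem_insert, Finset.mem_singleton]; grind
  have hK : ∀ V ∈ F, AltFree (V : Set ℕ) K := fun V hV =>
    altFree_of_insert hab.ne (hcard V hV) (hpair V hV _ haF) (hpair V hV _ hbF)
  have hZ : ∀ V ∈ F, AltFree (V : Set ℕ) Z := fun V hV =>
    altFree_insert_insert (hcard V hV) (hpair V hV _ haF) (hpair V hV _ hbF)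
  let G : Set (Set ℕ) := {S | ∃ V ∈ F, S = (V : Set ℕ)}
  have hmemZ : ∀ t, t ∈ (Z : Set ℕ) ↔ t = a ∨ t = b ∨ t ∈ K := by intro t; simp [hZdef]
  have outer : (((∃ y ∈ (Z : Set ℕ), (y < a ∨ b < y)) ∧
        ∀ V ∈ G, b ∉ V → a ∉ V → ∀ w ∈ V, w ∉ (Z : Set ℕ) → ¬ (a < w ∧ w < b)) ∨
      ∃ V₂ ∈ G, b ∈ V₂ ∧ a ∈ V₂ ∧ (∃ y ∈ (Z : Set ℕ), (y < a ∨ b < y) ∧ y ∉ V₂) ∧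
        ∀ V ∈ G, b ∉ V → a ∉ V → (∃ w ∈ V, w ∉ (Z : Set ℕ) ∧ (a < w ∧ w < b)) →
          (∀ t ∈ (Z : Set ℕ), (t < a ∨ b < t) → t ∉ V₂ → t ∉ V) ∧
            ∃ w ∈ V, w ∉ V₂ ∧ (a < w ∧ w < b)) →
      ∃ y ∈ K, (y < a ∨ b < y) ∧ ∀ V ∈ F, AltFree (V : Set ℕ) (Z.erase y : Finset ℕ) := by
    intro h
    obtain ⟨y, h1, h2, h3⟩ := exists_altFree_erase_outer (b := b) (a := a) (Z := Z) (F := G) hab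
      Z.finite_toSet (by simp [hZdef]) (by simp [hZdef])
      (by rintro _ ⟨V, hV, rfl⟩ _ ⟨W, hW, rfl⟩; exact hpair V hV W hW)
      (by rintro _ ⟨V, hV, rfl⟩; exact hZ V hV)
      (by
        rintro _ ⟨V, hV, rfl⟩
        have := hpair V hV _ haF
        rw [← hZb] at this; simpa using this)
      (by
        rintro _ ⟨V, hV, rfl⟩
        have := hpair V hV _ hbF
        rw [← hZa] at this; simpa using this) h
    refine ⟨y, ?_, h2, fun V hV => ?_⟩
    · rcases (hmemZ y).1 h1 with h | h | h
      · omega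
      · omega
      · exact h
    · simpa using h3 V ⟨V, hV, rfl⟩
  have inner : (((∃ x, x ∉ (K : Set ℕ) ∧ a < x ∧ x < b) ∧
        ∀ V ∈ G, b ∈ V → a ∈ V → ∀ w ∈ (K : Set ℕ), w ∉ V → ¬ (w < a ∨ b < w)) ∨
      ∃ V₁ ∈ G, b ∉ V₁ ∧ a ∉ V₁ ∧ (∃ x, x ∉ (K : Set ℕ) ∧ (a < x ∧ x < b) ∧ x ∈ V₁) ∧
        ∀ V ∈ G, b ∈ V → a ∈ V → (∃ w ∈ (K : Set ℕ), w ∉ V ∧ (w < a ∨ b < w)) →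
          (∀ t ∉ (K : Set ℕ), a < t → t < b → t ∈ V₁ → t ∈ V) ∧
            ∃ w ∈ V₁, w ∉ V ∧ (w < a ∨ b < w)) →
      ∃ x, x ∉ K ∧ (a < x ∧ x < b) ∧ ∀ V ∈ F, AltFree (V : Set ℕ) (insert x K : Finset ℕ) := by
    intro h
    obtain ⟨x, h1, h2, h3⟩ := exists_altFree_insert_inner (b := b) (a := a) (K := K) (F := G)
      (by simpa using hb) (by simpa using ha)
      (by rintro _ ⟨V, hV, rfl⟩ _ ⟨W, hW, rfl⟩; exact hpair V hV W hW)
      (by rintro _ ⟨V, hV, rfl⟩; exact hK V hV)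
      (by rintro _ ⟨V, hV, rfl⟩; simpa using hpair V hV _ hbF)
      (by rintro _ ⟨V, hV, rfl⟩; simpa using hpair V hV _ haF) h
    exact ⟨x, by simpa using h1, h2, fun V hV => by simpa using h3 V ⟨V, hV, rfl⟩⟩
  let I := F.filter fun V => a ∉ V ∧ b ∉ V ∧ ∃ w ∈ V, w ∉ K ∧ a < w ∧ w < b
  let J := F.filter fun V => a ∈ V ∧ b ∈ V ∧ ∃ y ∈ K, y ∉ V ∧ (y < a ∨ b < y)
  have hIm : ∀ V ∈ F, b ∉ (V : Set ℕ) → a ∉ (V : Set ℕ) → ∀ w ∈ (V : Set ℕ), w ∉ (Z : Set ℕ) →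
      (a < w ∧ w < b) → V ∈ I := by
    intro V hV h1 h2 w h3 h4 h5
    refine Finset.mem_filter.2 ⟨hV, h2, h1, w, h3, fun h => h4 ((hmemZ w).2 ?_), h5⟩
    tauto
  have hJm : ∀ V ∈ F, b ∈ (V : Set ℕ) → a ∈ (V : Set ℕ) → ∀ w ∈ (K : Set ℕ), w ∉ (V : Set ℕ) →
      (w < a ∨ b < w) → V ∈ J := by
    intro V hV h1 h2 w h3 h4 h5
    exact Finset.mem_filter.2 ⟨hV, h2, h1, w, h3, h4, h5⟩
  by_cases hJ : J.Nonempty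
  swap
  · by_cases hX : ∃ x, x ∉ K ∧ a < x ∧ x < b
    · left
      refine inner (Or.inl ⟨by simpa using hX, ?_⟩)
      rintro _ ⟨V, hV, rfl⟩ h1 h2 w h3 h4 h5
      exact hJ ⟨V, hJm V hV h1 h2 w h3 h4 h5⟩
    · right
      obtain ⟨y, hy, hy'⟩ := hne.resolve_left hX
      refine outer (Or.inl ⟨⟨y, (hmemZ y).2 (by tauto), hy'⟩, ?_⟩)
      rintro _ ⟨V, hV, rfl⟩ h1 h2 w h3 h4 h5
      exact hX ⟨w, fun h => h4 ((hmemZ w).2 (by tauto)), h5⟩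
  by_cases hI : I.Nonempty
  swap
  · right
    obtain ⟨V, hV⟩ := hJ
    obtain ⟨-, -, -, y, hy, -, hy'⟩ := Finset.mem_filter.1 hV
    refine outer (Or.inl ⟨⟨y, (hmemZ y).2 (by tauto), hy'⟩, ?_⟩)
    rintro _ ⟨V, hV, rfl⟩ h1 h2 w h3 h4 h5
    exact hI ⟨V, hIm V hV h1 h2 w h3 h4 h5⟩
  let dom : Finset ℕ → Finset ℕ → Prop := fun V₁ V₂ => ∃ w ∈ V₁, w ∉ V₂ ∧ a < w ∧ w < b
  have dom_outer : ∀ V₁ ∈ I, ∀ V₂ ∈ J, dom V₁ V₂ → ∀ t ∈ V₁, (t < a ∨ b < t) → t ∈ V₂ := by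
    rintro V₁ h1 V₂ h2 ⟨w, h3, h4, h5⟩ t h6 h7
    by_contra h8
    obtain ⟨h1, k1, k2, -⟩ := Finset.mem_filter.1 h1
    obtain ⟨h2, m1, m2, -⟩ := Finset.mem_filter.1 h2
    exact (hpair V₂ h2 V₁ h1).cyc (p := a) (q := w) (r := b) (s := t) (by omega) m1 k1 h3 h4 m2 k2 h6 h8
  have ndom_outer : ∀ V₁ ∈ I, ∀ V₂ ∈ J, ¬ dom V₁ V₂ → ∃ t ∈ V₁, t ∉ V₂ ∧ (t < a ∨ b < t) := by
    rintro V₁ h1 V₂ h2 h3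
    obtain ⟨h1, k1, k2, -⟩ := Finset.mem_filter.1 h1
    obtain ⟨h2, m1, m2, -⟩ := Finset.mem_filter.1 h2
    by_contra! hcon
    have hsub : V₁ ⊆ V₂ := by
      intro t ht
      by_contra htV
      have := hcon t ht htV
      have h4 : t ≠ a := by rintro rfl; exact k1 ht
      have h5 : t ≠ b := by rintro rfl; exact k2 ht
      exact h3 ⟨t, ht, htV, by omega⟩
    have := Finset.eq_of_subset_of_card_le hsub (by rw [hcard _ h1, hcard _ h2])
    exact k1 (this ▸ m1)
  have ndom_inner : ∀ V₁ V₂, ¬ dom V₁ V₂ → ∀ t ∈ V₁, a < t → t < b → t ∈ V₂ := by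
    intro V₁ V₂ h t h1 h2 h3
    by_contra h4
    exact h ⟨t, h1, h4, h2, h3⟩
  rcases exists_full_or_empty I J hJ dom (by
    intro V₁ h1 V₁' h1' V₂ h2 V₂' h2' d1 d2 d3 d4
    obtain ⟨p, hp, hp', hp''⟩ := id d1
    obtain ⟨p', hq, hq', hq''⟩ := id d3
    obtain ⟨r, hr, hr', hr''⟩ := ndom_outer _ h1' _ h2 d2
    obtain ⟨r', hs, hs', hs''⟩ := ndom_outer _ h1 _ h2' d4
    have e1 := ndom_inner _ _ d4 p hp hp''.1 hp''.2
    have e2 : p' ∉ V₁ := fun h => hq' (ndom_inner _ _ d4 p' h hq''.1 hq''.2)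
    have e3 := ndom_inner _ _ d2 p' hq hq''.1 hq''.2
    have e4 : p ∉ V₁' := fun h => hp' (ndom_inner _ _ d2 p h hp''.1 hp''.2)
    have e5 : r ∉ V₁ := fun h => hr' (dom_outer _ h1 _ h2 d1 r h hr'')
    have e6 := dom_outer _ h1 _ h2 d1 r' hs hs''
    have e7 : r' ∉ V₁' := fun h => hs' (dom_outer _ h1' _ h2' d3 r' h hs'')
    have e8 := dom_outer _ h1' _ h2' d3 r hr hr''
    have n1 : p ≠ p' := by rintro rfl; exact e2 hp
    have n2 : r ≠ r' := by rintro rfl; exact e5 hs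
    have hc := cyc4_or_of_inner_outer hp'' hq'' hr'' hs'' n1 n2
    have s1 := hpair V₁ (Finset.mem_filter.1 h1).1 V₁' (Finset.mem_filter.1 h1').1
    have s2 := hpair V₂' (Finset.mem_filter.1 h2').1 V₂ (Finset.mem_filter.1 h2).1
    rcases hc with (hc | hc) | hc | hc
    · exact s1.cyc hc hp e4 hq e2 hs e7 hr e5
    · exact s1.cyc hc hp e4 hr e5 hs e7 hq e2
    · exact s2.cyc hc e1 hp' e3 hq' e8 hr' e6 hs'
    · exact s2.cyc hc e1 hp' e6 hs' e8 hr' e3 hq') with ⟨V₂, h2, hd⟩ | ⟨V₁, h1, hd⟩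
  · right
    obtain ⟨h2', m1, m2, y, m3, m4, m5⟩ := Finset.mem_filter.1 h2
    refine outer (Or.inr ⟨V₂, ⟨V₂, h2', rfl⟩, m2, m1, ⟨y, (hmemZ y).2 (by tauto), m5, m4⟩, ?_⟩)
    rintro _ ⟨V, hV, rfl⟩ k1 k2 ⟨w, k3, k4, k5⟩
    have hVI := hIm V hV k1 k2 w k3 k4 k5
    exact ⟨fun t _ h4 h5 h6 => h5 (dom_outer V hVI V₂ h2 (hd V hVI) t h6 h4), hd V hVI⟩
  · left
    obtain ⟨h1', m1, m2, y, m3, m4, m5⟩ := Finset.mem_filter.1 h1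
    refine inner (Or.inr ⟨V₁, ⟨V₁, h1', rfl⟩, m2, m1, ⟨y, m4, m5, m3⟩, ?_⟩)
    rintro _ ⟨V, hV, rfl⟩ k1 k2 ⟨w, k3, k4, k5⟩
    have hVJ := hJm V hV k1 k2 w k3 k4 k5
    exact ⟨fun t _ h4 h5 h6 => ndom_inner V₁ V (hd V hVJ) t h6 h4 h5,
      ndom_outer V₁ h1 V hVJ (hd V hVJ)⟩

end EdgeLemma

section Mutation

theorem not_alternating_of_cyc4 {i j k l x y : ℕ} (hc : Cyc4 i j k l)
    (hxi : x ≠ i) (hxk : x ≠ k) (hxj : x ≠ j) (hxl : x ≠ l)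
    (hyi : y ≠ i) (hyk : y ≠ k) (hyj : y ≠ j) (hyl : y ≠ l) (hxy : x ≠ y) :
    Cyc4 k j x y ∨ Cyc4 k y x j ∨ Cyc4 i j x y ∨ Cyc4 i y x j ∨
    Cyc4 i l x y ∨ Cyc4 i y x l ∨ Cyc4 k l x y ∨ Cyc4 k y x l := by
  unfold Cyc4 at *
  rcases lt_or_gt_of_ne hxi with hxi | hxi <;> rcases lt_or_gt_of_ne hxj with hxj | hxj <;>
  rcases lt_or_gt_of_ne hxk with hxk | hxk <;> rcases lt_or_gt_of_ne hxl with hxl | hxl <;>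
  rcases lt_or_gt_of_ne hxy with hxy | hxy <;>
  rcases lt_or_gt_of_ne hyi with hyi | hyi <;> rcases lt_or_gt_of_ne hyj with hyj | hyj <;>
  simp only [hxj, hxl, hyi, hxy, hxj.not_gt, hxl.not_gt, hyi.not_gt, hxy.not_gt, true_and, and_true, true_or, or_true, and_false,
      false_and, or_false, false_or] <;>
  rcases lt_or_gt_of_ne hyk with hyk | hyk <;> rcases lt_or_gt_of_ne hyl with hyl | hyl <;>
  simp only [hyk, hyk.not_gt, true_and, and_true, true_or, or_true, and_false,
      false_and, or_false, false_or] <;> omega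

/-- Separation from the four sides of a quadrilateral passes to its diagonal. -/
theorem altFree_diagonal {i j k l : ℕ} (hc : Cyc4 i j k l) {S V : Finset ℕ}
    (hi : i ∉ S) (hj : j ∉ S) (hk : k ∉ S) (hl : l ∉ S) (hcard : #V = #S + 2)
    (hij : AltFree (V : Set ℕ) (insert i (insert j S) : Finset ℕ))
    (hjk : AltFree (V : Set ℕ) (insert j (insert k S) : Finset ℕ))
    (hkl : AltFree (V : Set ℕ) (insert k (insert l S) : Finset ℕ))
    (hil : AltFree (V : Set ℕ) (insert i (insert l S) : Finset ℕ))
    (hne : V ≠ insert i (insert k S)) :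
    AltFree (V : Set ℕ) (insert j (insert l S) : Finset ℕ) := by
  have hne' := hc.ne
  have hjS : AltFree (V : Set ℕ) (insert j S : Finset ℕ) :=
    altFree_of_insert (a := i) (b := k) hne'.1 (by rw [card_insert_of_notMem hj, hcard]) hij
      (by rwa [insert_comm])
  have hlS : AltFree (V : Set ℕ) (insert l S : Finset ℕ) :=
    altFree_of_insert (a := i) (b := k) hne'.1 (by rw [card_insert_of_notMem hl, hcard]) hil hkl
  have hijl : AltFree (V : Set ℕ) (insert j (insert l (insert i S)) : Finset ℕ) :=
    altFree_insert_insert (by rw [card_insert_of_notMem hi, hcard]) (by rwa [insert_comm])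
      (by rwa [insert_comm])
  have hjkl : AltFree (V : Set ℕ) (insert j (insert l (insert k S)) : Finset ℕ) :=
    altFree_insert_insert (by rw [card_insert_of_notMem hk, hcard]) hjk (by rwa [insert_comm])
  refine altFree_of_cyc fun p q r s hc' hp hp' hq hq' hr hr' hs hs' => ?_
  have hjV : j ∉ V ∧ l ∉ V ∧ i ∈ V ∧ k ∈ V := by
    have e1 := fun h1 h2 h3 h4 => hlS.cyc hc' hp h1 h2 hq' hr h3 h4 hs'
    have e2 := fun h1 h2 h3 h4 => hjS.cyc hc' hp h1 h2 hq' hr h3 h4 hs'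
    have e3 := fun h1 h2 h3 h4 => hijl.cyc hc' hp h1 h2 hq' hr h3 h4 hs'
    have e4 := fun h1 h2 h3 h4 => hjkl.cyc hc' hp h1 h2 hq' hr h3 h4 hs'
    simp only [mem_coe, mem_insert, not_or] at *
    refine ⟨?_, ?_, ?_, ?_⟩
    · clear e2 e3 e4; grind
    · clear e1 e3 e4; grind
    · clear e1 e2 e4; grind
    · clear e1 e2 e3; grind
  clear hc' hp hp' hq hq' hr hr' hs hs'
  obtain ⟨hjV, hlV, hiV, hkV⟩ := hjV
  have hcard' : #(insert i (insert k S)) = #V := by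
    rw [card_insert_of_notMem (by simp [hi, hne'.1]), card_insert_of_notMem hk, hcard]
  obtain ⟨x, hx, hx'⟩ : ∃ x ∈ V, x ∉ insert i (insert k S) := by
    by_contra! h
    exact hne (eq_of_subset_of_card_le h hcard'.le)
  obtain ⟨y, hy, hy'⟩ : ∃ y ∈ insert i (insert k S), y ∉ V := by
    by_contra! h
    exact hne (eq_of_subset_of_card_le h hcard'.ge).symm
  simp only [mem_insert, not_or] at hx' hy
  have hyi : y ≠ i := by rintro rfl; exact hy' hiV
  have hyk : y ≠ k := by rintro rfl; exact hy' hkV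
  have hyS : y ∈ S := by tauto
  have hyj : y ≠ j := by rintro rfl; exact hj hyS
  have hyl : y ≠ l := by rintro rfl; exact hl hyS
  have hxj : x ≠ j := by rintro rfl; exact hjV hx
  have hxl : x ≠ l := by rintro rfl; exact hlV hx
  have hxy : x ≠ y := by rintro rfl; exact hy' hx
  have hij' : i ≠ j := by rintro rfl; exact hjV hiV
  have hil' : i ≠ l := by rintro rfl; exact hlV hiV
  have hkj' : k ≠ j := by rintro rfl; exact hjV hkV
  have hkl' : k ≠ l := by rintro rfl; exact hlV hkV
  rcases not_alternating_of_cyc4 hc hx'.1 hx'.2.1 hxj hxl hyi hyk hyj hyl hxy with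
    h | h | h | h | h | h | h | h
  · exact hij.cyc h hkV (by simp [hk, hkj', hne'.1.symm]) (by simp) hjV hx (by simp [hx', hxj]) (by simp [hyS]) hy'
  · exact hij.cyc h hkV (by simp [hk, hkj', hne'.1.symm]) (by simp [hyS]) hy' hx (by simp [hx', hxj]) (by simp) hjV
  · exact hjk.cyc h hiV (by simp [hi, hij', hne'.1]) (by simp) hjV hx (by simp [hx', hxj]) (by simp [hyS]) hy'
  · exact hjk.cyc h hiV (by simp [hi, hij', hne'.1]) (by simp [hyS]) hy' hx (by simp [hx', hxj]) (by simp) hjV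
  · exact hkl.cyc h hiV (by simp [hi, hil', hne'.1]) (by simp) hlV hx (by simp [hx', hxl]) (by simp [hyS]) hy'
  · exact hkl.cyc h hiV (by simp [hi, hil', hne'.1]) (by simp [hyS]) hy' hx (by simp [hx', hxl]) (by simp) hlV
  · exact hil.cyc h hkV (by simp [hk, hkl', hne'.1.symm]) (by simp) hlV hx (by simp [hx', hxl]) (by simp [hyS]) hy'
  · exact hil.cyc h hkV (by simp [hk, hkl', hne'.1.symm]) (by simp [hyS]) hy' hx (by simp [hx', hxl]) (by simp) hlV

end Mutation

section WeakSeparation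

theorem setLT_iff {A B : Finset ℕ} (hB : B.Nonempty) (h0 : 0 ∉ B) :
    SetLT A B ↔ ∀ a ∈ A, ∀ b ∈ B, a < b := by
  unfold SetLT max0 min0
  rw [dif_pos hB]
  split_ifs with h
  · constructor
    · intro hlt a ha b hb
      exact (le_max' A a ha).trans_lt (hlt.trans_le (min'_le B b hb))
    · intro hlt
      exact hlt _ (max'_mem A h) _ (min'_mem B hB)
  · rw [not_nonempty_iff_eq_empty] at h
    subst h
    simp only [notMem_empty, false_imp_iff, implies_true, iff_true]
    exact Nat.pos_of_ne_zero fun hh => h0 (hh ▸ min'_mem B hB)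

theorem SetLT.lt {A B : Finset ℕ} (h : SetLT A B) {a b : ℕ} (ha : a ∈ A) (hb : b ∈ B) : a < b := by
  unfold SetLT max0 min0 at h
  rw [dif_pos ⟨a, ha⟩, dif_pos ⟨b, hb⟩] at h
  exact (le_max' A a ha).trans_lt (h.trans_le (min'_le B b hb))

theorem WeaklySep.symm {A B : Finset ℕ} (h : WeaklySep A B) : WeaklySep B A := by
  unfold WeaklySep StronglySep at *
  rcases h with (h | h | h) | h | h
  · exact Or.inl (Or.inr (Or.inl h))
  · exact Or.inl (Or.inl h)
  · exact Or.inl (Or.inr (Or.inr h.symm))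
  · exact Or.inr (Or.inr h)
  · exact Or.inr (Or.inl h)

theorem weaklySep_of_no_straddle {A B : Finset ℕ} (hA0 : 0 ∉ A) (hB0 : 0 ∉ B) (hcard : #B ≤ #A)
    (h : ∀ a ∈ A, a ∉ B → ∀ b ∈ B, b ∉ A → ∀ a' ∈ A, a' ∉ B → a < b → b < a' → False) :
    WeaklySep A B := by
  have hA0' : 0 ∉ A \ B := fun h => hA0 (mem_sdiff.1 h).1
  have hB0' : 0 ∉ B \ A := fun h => hB0 (mem_sdiff.1 h).1
  by_cases hA : (A \ B).Nonempty
  swap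
  · left; right; right
    rw [not_nonempty_iff_eq_empty, sdiff_eq_empty_iff_subset] at hA
    exact eq_of_subset_of_card_le hA hcard
  set L := (B \ A).filter fun b => ∃ a ∈ A \ B, b < a with hL
  set U := (B \ A).filter fun b => ∃ a ∈ A \ B, a < b with hU
  have hLlt : ∀ b ∈ L, ∀ a ∈ A \ B, b < a := by
    intro b hb a ha
    obtain ⟨hb, a', ha', hlt⟩ := mem_filter.1 hb
    simp only [mem_sdiff] at *
    by_contra hn
    have : a ≠ b := by rintro rfl; exact hb.2 ha.1
    exact h a ha.1 ha.2 b hb.1 hb.2 a' ha'.1 ha'.2 (by omega) hlt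
  have hUlt : ∀ a ∈ A \ B, ∀ b ∈ U, a < b := by
    intro a ha b hb
    obtain ⟨hb, a', ha', hlt⟩ := mem_filter.1 hb
    simp only [mem_sdiff] at *
    by_contra hn
    have : a ≠ b := by rintro rfl; exact hb.2 ha.1
    exact h a' ha'.1 ha'.2 b hb.1 hb.2 a ha.1 ha.2 hlt (by omega)
  have hLU : L ∪ U = B \ A := by
    ext b
    simp only [hL, hU, mem_union, mem_filter]
    constructor
    · tauto
    · intro hb
      obtain ⟨a, ha⟩ := hA
      have : a ≠ b := by
        rintro rfl
        exact (mem_sdiff.1 hb).2 (mem_sdiff.1 ha).1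
      rcases lt_or_gt_of_ne this with h | h
      · exact Or.inr ⟨hb, a, ha, h⟩
      · exact Or.inl ⟨hb, a, ha, h⟩
  by_cases hLe : L.Nonempty
  swap
  · rw [not_nonempty_iff_eq_empty] at hLe
    rw [hLe, empty_union] at hLU
    by_cases hB : (B \ A).Nonempty
    · exact Or.inl (Or.inl ((setLT_iff hB hB0').2 fun a ha b hb => hUlt a ha b (hLU ▸ hb)))
    · rw [not_nonempty_iff_eq_empty] at hB
      exact Or.inl (Or.inr (Or.inl ((setLT_iff hA hA0').2 (by simp [hB]))))
  by_cases hUe : U.Nonempty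
  swap
  · rw [not_nonempty_iff_eq_empty] at hUe
    rw [hUe, union_empty] at hLU
    exact Or.inl (Or.inr (Or.inl ((setLT_iff hA hA0').2 fun b hb a ha =>
      hLlt b (hLU ▸ hb) a ha)))
  have hU0 : 0 ∉ U := fun h => hB0' (mem_filter.1 h).1
  exact Or.inr (Or.inl ⟨⟨hA, L, U, hLe, hUe, hLU, (setLT_iff hA hA0').2 hLlt,
    (setLT_iff hUe hU0).2 hUlt⟩, hcard⟩)

theorem WeaklySep.altFree {A B : Finset ℕ} (h : WeaklySep A B) : AltFree (A : Set ℕ) B := by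
  have hlt : ∀ {A B : Finset ℕ}, LessDot A B → ∀ x y, x ∈ B → x ∉ A → y ∈ A → y ∉ B → y < x := by
    intro A B h x y h1 h2 h3 h4
    exact h.lt (mem_sdiff.2 ⟨h3, h4⟩) (mem_sdiff.2 ⟨h1, h2⟩)
  have hsp : ∀ {A B : Finset ℕ}, Splits A B → ∀ x y z, x ∈ A → x ∉ B → y ∈ B → y ∉ A → z ∈ A →
      z ∉ B → x < y → y < z → False := by
    rintro A B ⟨-, L, U, -, -, hLU, hL, hU⟩ x y z h1 h2 h3 h4 h5 h6 h7 h8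
    have hy : y ∈ L ∪ U := hLU ▸ mem_sdiff.2 ⟨h3, h4⟩
    rcases mem_union.1 hy with hy | hy
    · exact (hL.lt hy (mem_sdiff.2 ⟨h1, h2⟩)).not_gt h7
    · exact (hU.lt (mem_sdiff.2 ⟨h5, h6⟩) hy).not_gt h8
  intro p q r s hpq hqr hrs
  simp only [mem_coe]
  rcases h with (h | h | rfl) | h | h
  · constructor <;> rintro ⟨h1, h2, h3, h4, h5, h6, h7, h8⟩
    · exact (hlt h q r h3 h4 h5 h6).not_gt hqr
    · exact (hlt h p q h1 h2 h3 h4).not_gt hpq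
  · constructor <;> rintro ⟨h1, h2, h3, h4, h5, h6, h7, h8⟩
    · exact (hlt h p q h1 h2 h3 h4).not_gt hpq
    · exact (hlt h q r h3 h4 h5 h6).not_gt hqr
  · tauto
  · constructor <;> rintro ⟨h1, h2, h3, h4, h5, h6, h7, h8⟩
    · exact hsp h.1 p q r h1 h2 h3 h4 h5 h6 hpq hqr
    · exact hsp h.1 q r s h3 h4 h5 h6 h7 h8 hqr hrs
  · constructor <;> rintro ⟨h1, h2, h3, h4, h5, h6, h7, h8⟩
    · exact hsp h.1 q r s h3 h4 h5 h6 h7 h8 hqr hrs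
    · exact hsp h.1 p q r h1 h2 h3 h4 h5 h6 hpq hqr

theorem WeaklySep.no_straddle {A B : Finset ℕ} (h : WeaklySep A B) (hcard : #B < #A) {x y z : ℕ}
    (hx : x ∈ A) (hx' : x ∉ B) (hy : y ∈ B) (hy' : y ∉ A) (hz : z ∈ A) (hz' : z ∉ B)
    (hxy : x < y) (hyz : y < z) : False := by
  have h1 := mem_sdiff.2 ⟨hx, hx'⟩
  have h2 := mem_sdiff.2 ⟨hy, hy'⟩
  have h3 := mem_sdiff.2 ⟨hz, hz'⟩
  rcases h with (h | h | rfl) | ⟨h, -⟩ | ⟨-, h⟩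
  · exact (h.lt h3 h2).not_gt hyz
  · exact (h.lt h2 h1).not_gt hxy
  · exact hx' hx
  · obtain ⟨-, L, U, -, -, hLU, hL, hU⟩ := h
    rw [← hLU] at h2
    rcases mem_union.1 h2 with hy | hy
    · exact (hL.lt hy h1).not_gt hxy
    · exact (hU.lt h3 hy).not_gt hyz
  · omega

theorem AltFree.weaklySep {A B : Finset ℕ} (h : AltFree (A : Set ℕ) B) (hA0 : 0 ∉ A) (hB0 : 0 ∉ B)
    (hcard : #A = #B) : WeaklySep A B := by
  by_cases h1 : ∀ a ∈ A, a ∉ B → ∀ b ∈ B, b ∉ A → ∀ a' ∈ A, a' ∉ B → a < b → b < a' → False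
  · exact weaklySep_of_no_straddle hA0 hB0 hcard.ge h1
  refine (weaklySep_of_no_straddle hB0 hA0 hcard.le ?_).symm
  push Not at h1
  obtain ⟨a, ha, ha', b, hb, hb', c, hc, hc', hab, hbc, -⟩ := h1
  intro x hx hx' y hy hy' z hz hz' hxy hyz
  have hxa : x ≠ a := by rintro rfl; exact ha' hx
  have hzc : z ≠ c := by rintro rfl; exact hc' hz
  rcases lt_or_gt_of_ne hxa with h1 | h1
  · exact (h x a b c h1 hab hbc).2 (by simp; tauto)
  rcases lt_or_gt_of_ne hzc with h2 | h2
  · exact (h a x y z h1 hxy hyz).1 (by simp; tauto)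
  · exact (h a b c z hab hbc h2).1 (by simp; tauto)

/-- `A ⊆ [1, n]` filled up to size `M` by the elements following `n`. -/
def pad (n M : ℕ) (A : Finset ℕ) : Finset ℕ := A ∪ Ioc n (n + (M - #A))

variable {n M : ℕ} {A B : Finset ℕ}

theorem mem_pad {x : ℕ} : x ∈ pad n M A ↔ x ∈ A ∨ n < x ∧ x ≤ n + (M - #A) := by simp [pad]

theorem card_pad (hA : A ⊆ Icc 1 n) (hM : #A ≤ M) : #(pad n M A) = M := by
  rw [pad, card_union_of_disjoint, Nat.card_Ioc]
  · omega
  · rw [disjoint_left]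
    intro x hx hx'
    have := mem_Icc.1 (hA hx)
    have := mem_Ioc.1 hx'
    omega

theorem weaklySep_iff_pad (hA : A ⊆ Icc 1 n) (hB : B ⊆ Icc 1 n) (hAM : #A ≤ M) (hBM : #B ≤ M) :
    WeaklySep A B ↔ AltFree (pad n M A : Set ℕ) (pad n M B : Finset ℕ) := by
  wlog hcard : #B ≤ #A generalizing A B
  · have := this hB hA hBM hAM (by omega)
    exact ⟨fun h => (this.1 h.symm).symm, fun h => (this.2 h.symm).symm⟩
  have hA0 : 0 ∉ A := fun h => by simpa using hA h
  have hB0 : 0 ∉ B := fun h => by simpa using hB h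
  have hAn : ∀ {x}, x ∈ A → x ≤ n := fun h => (mem_Icc.1 (hA h)).2
  have hBn : ∀ {x}, x ∈ B → x ≤ n := fun h => (mem_Icc.1 (hB h)).2
  have hmA : ∀ x, x ∈ pad n M A → x ∉ pad n M B → x ∈ A ∧ x ∉ B := by
    intro x h1 h2
    rw [mem_pad] at h1 h2
    constructor
    · rcases h1 with h1 | h1
      · exact h1
      · omega
    · tauto
  rcases hcard.eq_or_lt with heq | hlt
  · have hmB : ∀ x, x ∈ pad n M B → x ∉ pad n M A → x ∈ B ∧ x ∉ A := by
      intro x h1 h2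
      rw [mem_pad] at h1 h2
      rw [heq] at h1
      tauto
    have hmA' : ∀ x, x ∈ A → x ∉ B → x ∈ pad n M A ∧ x ∉ pad n M B := by
      intro x h1 h2
      rw [mem_pad, mem_pad]
      have := hAn h1
      exact ⟨Or.inl h1, by simp [h2]; omega⟩
    have hmB' : ∀ x, x ∈ B → x ∉ A → x ∈ pad n M B ∧ x ∉ pad n M A := by
      intro x h1 h2
      rw [mem_pad, mem_pad]
      have := hBn h1
      exact ⟨Or.inl h1, by simp [h2]; omega⟩
    constructor
    · intro h
      refine altFree_of_cyc fun p q r s hc h1 h2 h3 h4 h5 h6 h7 h8 => ?_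
      have k1 := hmA p h1 h2
      have k2 := hmB q h3 h4
      have k3 := hmA r h5 h6
      have k4 := hmB s h7 h8
      exact h.altFree.cyc hc k1.1 k1.2 k2.1 k2.2 k3.1 k3.2 k4.1 k4.2
    · intro h
      refine AltFree.weaklySep (altFree_of_cyc fun p q r s hc h1 h2 h3 h4 h5 h6 h7 h8 => ?_)
        hA0 hB0 heq.symm
      have k1 := hmA' p h1 h2
      have k2 := hmB' q h3 h4
      have k3 := hmA' r h5 h6
      have k4 := hmB' s h7 h8
      exact h.cyc hc k1.1 k1.2 k2.1 k2.2 k3.1 k3.2 k4.1 k4.2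
  · constructor
    · intro h p q r s hpq hqr hrs
      simp only [mem_coe]
      constructor <;> rintro ⟨h1, h2, h3, h4, h5, h6, h7, h8⟩
      · have k1 := hmA p h1 h2
        have k3 := hmA r h5 h6
        have k2 : q ∈ B ∧ q ∉ A := by
          rw [mem_pad] at h3 h4
          have := hAn k3.1
          refine ⟨h3.resolve_right (by omega), by tauto⟩
        exact h.no_straddle hlt k1.1 k1.2 k2.1 k2.2 k3.1 k3.2 hpq hqr
      · have k1 := hmA q h3 h4
        have k3 := hmA s h7 h8
        have k2 : r ∈ B ∧ r ∉ A := by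
          rw [mem_pad] at h5 h6
          have := hAn k3.1
          refine ⟨h5.resolve_right (by omega), by tauto⟩
        exact h.no_straddle hlt k1.1 k1.2 k2.1 k2.2 k3.1 k3.2 hqr hrs
    · intro h
      refine weaklySep_of_no_straddle hA0 hB0 hcard fun a ha ha' b hb hb' c hc hc' hab hbc => ?_
      have := hAn ha
      have := hBn hb
      have := hAn hc
      refine (h a b c (n + (M - #B)) hab hbc (by omega)).1 ?_
      simp only [mem_coe, mem_pad, ha, hb, hc, ha', hb', hc', true_or, false_or, true_and]
      have hA' : n + (M - #B) ∉ A := fun h => by have := hAn h; omega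
      have hB' : n + (M - #B) ∉ B := fun h => by have := hBn h; omega
      simp only [hA', hB', false_or]
      omega

end WeakSeparation

section Flip

variable {n : ℕ}

theorem pad_insert {A : Finset ℕ} {x : ℕ} (hA : #A ≤ n) (hxA : x ∉ A) :
    pad n (n + 2) (insert x A) = insert x (insert (n + (n + 1 - #A)) (pad n n A)) := by
  ext t
  simp only [mem_pad, mem_insert, card_insert_of_notMem hxA, or_assoc]
  rcases eq_or_ne t x with h | h
  · simp [h]
  by_cases h' : t ∈ A
  · simp [h']
  simp only [h, h', false_or]
  omega

theorem pad_insert_insert {A : Finset ℕ} {x y : ℕ} (hxy : x ≠ y) (hxA : x ∉ A) (hyA : y ∉ A) :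
    pad n (n + 2) (insert x (insert y A)) = insert x (insert y (pad n n A)) := by
  have hx : x ∉ insert y A := by simp [hxy, hxA]
  ext t
  simp only [mem_pad, mem_insert, card_insert_of_notMem hx, card_insert_of_notMem hyA, or_assoc,
    Nat.add_assoc, Nat.reduceAdd, Nat.add_sub_add_right]

theorem pad_injOn {M : ℕ} {A B : Finset ℕ} (hA : A ⊆ Icc 1 n) (hB : B ⊆ Icc 1 n)
    (h : pad n M A = pad n M B) : A = B := by
  have key : ∀ {X : Finset ℕ}, X ⊆ Icc 1 n → (pad n M X).filter (· ≤ n) = X := by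
    intro X hX
    ext t
    rw [mem_filter, mem_pad]
    constructor
    · rintro ⟨h | h, h'⟩
      · exact h
      · omega
    · exact fun h => ⟨Or.inl h, (mem_Icc.1 (hX h)).2⟩
  rw [← key hA, ← key hB, h]

theorem WeaklySep.refl (A : Finset ℕ) : WeaklySep A A := Or.inl (Or.inr (Or.inr rfl))

theorem card_le_of_subset_Icc {A : Finset ℕ} (hA : A ⊆ Icc 1 n) : #A ≤ n := by
  simpa using card_le_card hA

theorem not_weaklySep_flip {i j k : ℕ} {A : Finset ℕ} (hij : i < j) (hjk : j < k) (hi : i ∉ A)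
    (hj : j ∉ A) (hk : k ∉ A) : ¬ WeaklySep (insert i (insert k A)) (insert j A) := by
  intro h
  refine h.no_straddle (x := i) (y := j) (z := k) ?_ (by simp) (by simp [hi, hij.ne]) (by simp)
    (by simp [hj, hij.ne', hjk.ne]) (by simp) (by simp [hk, hjk.ne']) hij hjk
  rw [card_insert_of_notMem (a := i) (by simp [hi]; omega), card_insert_of_notMem hk,
    card_insert_of_notMem hj]
  omega

/-- Lowering and raising preserve weak separation from sets separated from the four witnesses. -/
theorem weaklySep_flip {i j k : ℕ} {A V : Finset ℕ} (hi : i ∈ Icc 1 n) (hj : j ∈ Icc 1 n)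
    (hk : k ∈ Icc 1 n) (hij : i < j) (hjk : j < k) (hA : A ⊆ Icc 1 n) (hV : V ⊆ Icc 1 n)
    (hiA : i ∉ A) (hjA : j ∉ A) (hkA : k ∉ A)
    (h1 : WeaklySep V (insert i A)) (h2 : WeaklySep V (insert k A))
    (h3 : WeaklySep V (insert i (insert j A))) (h4 : WeaklySep V (insert j (insert k A))) :
    (V ≠ insert i (insert k A) → WeaklySep V (insert j A)) ∧
    (V ≠ insert j A → WeaklySep V (insert i (insert k A))) := by
  have hVn := card_le_of_subset_Icc hV
  have hAn := card_le_of_subset_Icc hA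
  have s1 : ∀ {x}, x ∈ Icc 1 n → insert x A ⊆ Icc 1 n := fun hx => insert_subset hx hA
  have s2 : ∀ {x y}, x ∈ Icc 1 n → y ∈ Icc 1 n → insert x (insert y A) ⊆ Icc 1 n :=
    fun hx hy => insert_subset hx (s1 hy)
  have e : ∀ {X}, X ⊆ Icc 1 n → (WeaklySep V X ↔
      AltFree (pad n (n + 2) V : Set ℕ) (pad n (n + 2) X : Finset ℕ)) := fun hX =>
    weaklySep_iff_pad hV hX (by omega) (by have := card_le_of_subset_Icc hX; omega)
  rw [e (s1 hi), pad_insert hAn hiA] at h1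
  rw [e (s1 hk), pad_insert hAn hkA] at h2
  rw [e (s2 hi hj), pad_insert_insert hij.ne hiA hjA] at h3
  rw [e (s2 hj hk), pad_insert_insert hjk.ne hjA hkA] at h4
  rw [e (s1 hj), pad_insert hAn hjA, e (s2 hi hk), pad_insert_insert (hij.trans hjk).ne hiA hkA]
  have hcard : #(pad n (n + 2) V) = #(pad n n A) + 2 := by
    rw [card_pad hV (by omega), card_pad hA hAn]
  simp only [mem_Icc] at hi hj hk
  have hS : ∀ {x}, x ≤ n → x ∉ A → x ∉ pad n n A := by
    intro x hx hxA h
    rcases mem_pad.1 h with h | h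
    · exact hxA h
    · omega
  have hlS : n + (n + 1 - #A) ∉ pad n n A := by
    rw [mem_pad]
    rintro (h | h)
    · have := mem_Icc.1 (hA h)
      omega
    · omega
  have hc : Cyc4 i j k (n + (n + 1 - #A)) := Or.inl ⟨hij, hjk, by omega⟩
  constructor
  · intro hne
    refine altFree_diagonal hc (hS hi.2 hiA) (hS hj.2 hjA) (hS hk.2 hkA) hlS hcard h3 h4 h2 h1 ?_
    rw [← pad_insert_insert (hij.trans hjk).ne hiA hkA]
    exact fun h => hne (pad_injOn hV (s2 (mem_Icc.2 hi) (mem_Icc.2 hk)) h)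
  · intro hne
    rw [insert_comm]
    refine altFree_diagonal hc.rot (hS hj.2 hjA) (hS hk.2 hkA) hlS (hS hi.2 hiA) hcard h4 h2
      (by rwa [insert_comm]) (by rwa [insert_comm]) ?_
    rw [← pad_insert hAn hjA]
    exact fun h => hne (pad_injOn hV (s1 (mem_Icc.2 hj)) h)

theorem IsMaxWColl.mem_of_weaklySep {D : Set (Finset ℕ)} {F : Finset (Finset ℕ)}
    (hF : IsMaxWColl D F) {X : Finset ℕ} (hX : X ∈ D) (h : ∀ V ∈ F, WeaklySep V X) : X ∈ F := by
  have := hF.2.2 (insert X F) (by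
      rw [coe_insert]; exact Set.insert_subset hX hF.1) (by
      intro A hA B hB
      rcases mem_insert.1 hA with rfl | hA' <;> rcases mem_insert.1 hB with rfl | hB'
      · exact WeaklySep.refl _
      · exact (h B hB').symm
      · exact h A hA'
      · exact hF.2.1 A hA' B hB') (subset_insert _ _)
  rw [this]
  exact mem_insert_self _ _

/-- A maximal w-collection with the pattern of a lowering flip is a raising flip of a maximal
w-collection of smaller total size. -/
theorem exists_lowering {F : Finset (Finset ℕ)}
    (hF : IsMaxWColl {X : Finset ℕ | X ⊆ Icc 1 n} F) {i j k : ℕ} {A : Finset ℕ}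
    (hij : i < j) (hjk : j < k) (hiA : i ∉ A) (hjA : j ∉ A) (hkA : k ∉ A)
    (h1 : insert i A ∈ F) (h2 : insert k A ∈ F) (h3 : insert i (insert j A) ∈ F)
    (h4 : insert j (insert k A) ∈ F) (h5 : insert i (insert k A) ∈ F) :
    ∃ F', IsMaxWColl {X : Finset ℕ | X ⊆ Icc 1 n} F' ∧ WeakRaisingFlip n F' F ∧
      ∑ X ∈ F', #X < ∑ X ∈ F, #X := by
  have hsub : ∀ {X}, X ∈ F → X ⊆ Icc 1 n := fun hX => hF.1 hX
  have hi : i ∈ Icc 1 n := hsub h1 (mem_insert_self _ _)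
  have hk : k ∈ Icc 1 n := hsub h2 (mem_insert_self _ _)
  have hj : j ∈ Icc 1 n := hsub h4 (mem_insert_self _ _)
  have hA : A ⊆ Icc 1 n := (subset_insert _ _).trans (hsub h1)
  have hns := not_weaklySep_flip hij hjk hiA hjA hkA
  have hjF : insert j A ∉ F := fun h => hns (hF.2.1 _ h5 _ h)
  have hflip := fun {V : Finset ℕ} (hV : V ⊆ Icc 1 n) =>
    weaklySep_flip hi hj hk hij hjk hA hV hiA hjA hkA
  have n1 : insert i A ≠ insert i (insert k A) := fun h => hkA (by
    have : k ∈ insert i A := by rw [h]; simp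
    exact (mem_insert.1 this).resolve_left (hij.trans hjk).ne')
  have n2 : insert k A ≠ insert i (insert k A) := fun h => hiA (by
    have : i ∈ insert k A := by rw [h]; simp
    exact (mem_insert.1 this).resolve_left (hij.trans hjk).ne)
  have n3 : insert i (insert j A) ≠ insert i (insert k A) := fun h => hjA (by
    have : j ∈ insert i (insert k A) := by rw [← h]; simp
    simpa [hij.ne', hjk.ne] using this)
  have n4 : insert j (insert k A) ≠ insert i (insert k A) := fun h => hjA (by
    have : j ∈ insert i (insert k A) := by rw [← h]; simp
    simpa [hij.ne', hjk.ne] using this)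
  have hFins : F = insert (insert i (insert k A))
      ((insert (insert j A) (F.erase (insert i (insert k A)))).erase (insert j A)) := by
    rw [erase_insert (fun h => hjF (mem_of_mem_erase h)), insert_erase h5]
  refine ⟨insert (insert j A) (F.erase (insert i (insert k A))), ⟨?_, ?_, ?_⟩, ?_, ?_⟩
  · intro X hX
    rcases mem_insert.1 (mem_coe.1 hX) with rfl | hX
    · exact insert_subset hj hA
    · exact hsub (mem_of_mem_erase hX)
  · have key : ∀ V ∈ F.erase (insert i (insert k A)), WeaklySep V (insert j A) := by
      intro V hV
      obtain ⟨hne, hV⟩ := mem_erase.1 hV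
      exact (hflip (hsub hV) (hF.2.1 _ hV _ h1) (hF.2.1 _ hV _ h2) (hF.2.1 _ hV _ h3)
        (hF.2.1 _ hV _ h4)).1 hne
    intro X hX Y hY
    rcases mem_insert.1 hX with rfl | hX <;> rcases mem_insert.1 hY with rfl | hY
    · exact WeaklySep.refl _
    · exact (key Y hY).symm
    · exact key X hX
    · exact hF.2.1 _ (mem_of_mem_erase hX) _ (mem_of_mem_erase hY)
  · intro G hGD hG hsubG
    refine hsubG.antisymm fun X hX => ?_
    by_cases hXj : X = insert j A
    · rw [hXj]
      exact mem_insert_self _ _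
    have hXF' : ∀ V ∈ F.erase (insert i (insert k A)), WeaklySep V X := fun V hV =>
      hG _ (hsubG (mem_insert_of_mem hV)) _ hX
    have hXs := fun {V : Finset ℕ} (h : V ∈ F) (h' : V ≠ insert i (insert k A)) =>
      (hXF' V (mem_erase.2 ⟨h', h⟩)).symm
    have hXik := (hflip (hGD hX) (hXs h1 n1) (hXs h2 n2) (hXs h3 n3) (hXs h4 n4)).2 hXj
    have hXF : X ∈ F := by
      refine hF.mem_of_weaklySep (hGD hX) fun V hV => ?_
      by_cases h : V = insert i (insert k A)
      · rw [h]
        exact hXik.symm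
      · exact (hXs hV h).symm
    refine mem_insert_of_mem (mem_erase.2 ⟨?_, hXF⟩)
    rintro rfl
    exact hns (hG _ hX _ (hsubG (mem_insert_self _ _)))
  · exact ⟨i, j, k, A, hi, hj, hk, hij, hjk, hA, hiA, hjA, hkA,
      mem_insert_of_mem (mem_erase.2 ⟨n1, h1⟩), mem_insert_of_mem (mem_erase.2 ⟨n2, h2⟩),
      mem_insert_of_mem (mem_erase.2 ⟨n3, h3⟩), mem_insert_of_mem (mem_erase.2 ⟨n4, h4⟩),
      mem_insert_self _ _, hFins⟩
  · rw [sum_insert (fun h => hjF (mem_of_mem_erase h)), ← add_sum_erase F _ h5,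
      card_insert_of_notMem hjA, card_insert_of_notMem (a := i), card_insert_of_notMem hkA]
    · omega
    · simp [hiA]
      omega

end Flip

section Intervals

variable {n : ℕ}

theorem mem_intervalColl {X : Finset ℕ} : X ∈ IntervalColl n ↔
    X ⊆ Icc 1 n ∧ ∀ x ∈ X, ∀ z ∈ X, ∀ y, x < y → y < z → y ∈ X := by
  simp only [IntervalColl, mem_insert, mem_image, mem_product, mem_Icc, Prod.exists]
  constructor
  · rintro (rfl | ⟨p, q, ⟨hp, hq⟩, rfl⟩)
    · simp
    · refine ⟨Icc_subset_Icc hp.1 hq.2, fun x hx z hz y hxy hyz => ?_⟩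
      simp only [mem_Icc] at *
      omega
  · rintro ⟨hX, hconv⟩
    rcases X.eq_empty_or_nonempty with h | h
    · exact Or.inl h
    refine Or.inr ⟨X.min' h, X.max' h, ⟨mem_Icc.1 (hX (min'_mem _ _)),
      mem_Icc.1 (hX (max'_mem _ _))⟩, ?_⟩
    ext y
    rw [mem_Icc]
    constructor
    · rintro ⟨h1, h2⟩
      rcases h1.eq_or_lt with h1 | h1
      · rw [← h1]
        exact min'_mem _ _
      rcases h2.eq_or_lt with h2 | h2
      · rw [h2]
        exact max'_mem _ _
      exact hconv _ (min'_mem _ h) _ (max'_mem _ h) y h1 h2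
    · exact fun hy => ⟨min'_le _ _ hy, le_max' _ _ hy⟩

theorem zero_notMem_of_subset_Icc {A : Finset ℕ} (hA : A ⊆ Icc 1 n) : 0 ∉ A :=
  fun h => by simpa using hA h

theorem weaklySep_of_mem_intervalColl {A B : Finset ℕ} (hA : A ∈ IntervalColl n)
    (hB : B ⊆ Icc 1 n) (hcard : #B ≤ #A) : WeaklySep A B := by
  obtain ⟨hA, hconv⟩ := mem_intervalColl.1 hA
  exact weaklySep_of_no_straddle (zero_notMem_of_subset_Icc hA) (zero_notMem_of_subset_Icc hB) hcard
    fun a ha _ b _ hb c hc _ hab hbc => hb (hconv a ha c hc b hab hbc)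

theorem singleton_mem_intervalColl {y : ℕ} (hy : y ∈ Icc 1 n) : {y} ∈ IntervalColl n := by
  refine mem_intervalColl.2 ⟨singleton_subset_iff.2 hy, fun x hx z hz t hxt htz => ?_⟩
  simp only [mem_singleton] at *
  omega

theorem isMaxWColl_intervalColl :
    IsMaxWColl {X : Finset ℕ | X ⊆ Icc 1 n} (IntervalColl n) := by
  refine ⟨fun X hX => (mem_intervalColl.1 hX).1, fun A hA B hB => ?_, fun G hG hGw hsub =>
    hsub.antisymm fun X hX => ?_⟩
  · rcases le_total #B #A with h | h
    · exact weaklySep_of_mem_intervalColl hA (mem_intervalColl.1 hB).1 h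
    · exact (weaklySep_of_mem_intervalColl hB (mem_intervalColl.1 hA).1 h).symm
  · refine mem_intervalColl.2 ⟨hG hX, fun x hx z hz y hxy hyz => ?_⟩
    by_contra hy
    have hyn : y ∈ Icc 1 n := by
      have h1 := mem_Icc.1 (hG hX hx)
      have h2 := mem_Icc.1 (hG hX hz)
      exact mem_Icc.2 ⟨by omega, by omega⟩
    refine (hGw X hX _ (hsub (singleton_mem_intervalColl hyn))).no_straddle ?_ hx (by simp; omega)
      (mem_singleton_self y) hy hz (by simp; omega) hxy hyz
    rw [card_singleton]
    exact one_lt_card.2 ⟨x, hx, z, hz, by omega⟩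

variable {F : Finset (Finset ℕ)}

theorem Icc_one_mem (hF : IsMaxWColl {X : Finset ℕ | X ⊆ Icc 1 n} F) {p : ℕ} (hp : p ≤ n) :
    Icc 1 p ∈ F := by
  refine hF.mem_of_weaklySep (Icc_subset_Icc le_rfl hp) fun V hV => ?_
  have hVn : V ⊆ Icc 1 n := hF.1 hV
  have hV0 := zero_notMem_of_subset_Icc hVn
  rcases le_total #(Icc 1 p) #V with h | h
  · refine weaklySep_of_no_straddle hV0 (by simp) h fun a _ ha b hb _ c _ _ hab _ => ?_
    have := mem_Icc.1 (hVn ‹a ∈ V›)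
    simp only [mem_Icc] at *
    omega
  · refine (weaklySep_of_no_straddle (by simp) hV0 h fun a _ _ b hb hb' c hc _ _ hbc => ?_).symm
    have := mem_Icc.1 (hVn hb)
    simp only [mem_Icc] at *
    omega

/-- If all intervals of size `m + 1` are present, the larger members are intervals. -/
theorem mem_intervalColl_of_card_lt (hF : IsMaxWColl {X : Finset ℕ | X ⊆ Icc 1 n} F) {m : ℕ}
    (hIcc : ∀ s, 1 ≤ s → s + m ≤ n → Icc s (s + m) ∈ F) {V : Finset ℕ} (hV : V ∈ F)
    (hm : m + 1 < #V) : V ∈ IntervalColl n := by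
  have hVn : V ⊆ Icc 1 n := hF.1 hV
  refine mem_intervalColl.2 ⟨hVn, fun x hx z hz y hxy hyz => ?_⟩
  by_contra hy
  have hne : V.Nonempty := ⟨x, hx⟩
  have h1 := min'_le V x hx
  have h2 := le_max' V z hz
  have hmin := min'_mem V hne
  have hmax := max'_mem V hne
  have hle : ∀ t ∈ V, V.min' hne ≤ t ∧ t ≤ V.max' hne := fun t ht => ⟨min'_le V t ht, le_max' V t ht⟩
  generalize V.min' hne = u at *
  generalize V.max' hne = v at *
  have hun := mem_Icc.1 (hVn hmin)
  have hvn := mem_Icc.1 (hVn hmax)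
  have hsub : V ⊆ (Icc u v).erase y := fun t ht =>
    mem_erase.2 ⟨fun h => hy (h ▸ ht), mem_Icc.2 (hle t ht)⟩
  have hcard := card_le_card hsub
  rw [card_erase_of_mem (mem_Icc.2 ⟨by omega, by omega⟩), Nat.card_Icc] at hcard
  obtain ⟨s, hs1, hs2, hs3, hs4⟩ : ∃ s, u < s ∧ s ≤ y ∧ y ≤ s + m ∧ s + m < v := by
    rcases le_or_gt (y - m) u with h | h
    · exact ⟨u + 1, by omega, by omega, by omega, by omega⟩
    · exact ⟨y - m, by omega, by omega, by omega, by omega⟩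
  refine (hF.2.1 V hV _ (hIcc s (by omega) (by omega))).no_straddle (x := u) (y := y) (z := v)
    ?_ hmin ?_ ?_ hy hmax ?_ (by omega) (by omega)
  · rw [Nat.card_Icc]
    omega
  · rw [mem_Icc]
    omega
  · rw [mem_Icc]
    omega
  · rw [mem_Icc]
    omega

end Intervals

section Descent

variable {n m : ℕ} {F : Finset (Finset ℕ)}

theorem pad_eq_self {X : Finset ℕ} (h : m ≤ #X) : pad n m X = X := by
  rw [pad, Nat.sub_eq_zero_of_le h]
  simp

theorem pad_succ_card (C : Finset ℕ) : pad n (#C + 1) C = insert (n + 1) C := by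
  rw [pad, Nat.add_sub_cancel_left]
  ext t
  simp only [mem_union, mem_Ioc, mem_insert]
  rw [or_comm]
  refine or_congr_left ?_
  omega

/-- The members of size at most `m`, filled up to size `m`. -/
def padColl (n m : ℕ) (F : Finset (Finset ℕ)) : Finset (Finset ℕ) :=
  (F.filter fun V => #V ≤ m).image (pad n m)

theorem mem_of_altFree_padColl (hF : IsMaxWColl {X : Finset ℕ | X ⊆ Icc 1 n} F)
    (hIcc : ∀ s, 1 ≤ s → s + m ≤ n → Icc s (s + m) ∈ F) {X : Finset ℕ} (hX : X ⊆ Icc 1 n)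
    (hXm : #X ≤ m + 1)
    (h : ∀ V ∈ padColl n (m + 1) F, AltFree (V : Set ℕ) (pad n (m + 1) X : Finset ℕ)) : X ∈ F := by
  refine hF.mem_of_weaklySep hX fun V hV => ?_
  rcases le_or_gt #V (m + 1) with hVm | hVm
  · exact (weaklySep_iff_pad (hF.1 hV) hX hVm hXm).2
      (h _ (mem_image_of_mem _ (mem_filter.2 ⟨hV, hVm⟩)))
  · exact weaklySep_of_mem_intervalColl (mem_intervalColl_of_card_lt hF hIcc hV hVm) hX (by omega)

theorem card_of_mem_padColl (hF : IsMaxWColl {X : Finset ℕ | X ⊆ Icc 1 n} F) {V : Finset ℕ}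
    (hV : V ∈ padColl n m F) : #V = m := by
  obtain ⟨W, hW, rfl⟩ := mem_image.1 hV
  obtain ⟨hW, hWm⟩ := mem_filter.1 hW
  exact card_pad (hF.1 hW) hWm

theorem altFree_of_mem_padColl (hF : IsMaxWColl {X : Finset ℕ | X ⊆ Icc 1 n} F) {V W : Finset ℕ}
    (hV : V ∈ padColl n m F) (hW : W ∈ padColl n m F) : AltFree (V : Set ℕ) W := by
  obtain ⟨V, hV', rfl⟩ := mem_image.1 hV
  obtain ⟨W, hW', rfl⟩ := mem_image.1 hW
  obtain ⟨hV, hVm⟩ := mem_filter.1 hV'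
  obtain ⟨hW, hWm⟩ := mem_filter.1 hW'
  exact (weaklySep_iff_pad (hF.1 hV) (hF.1 hW) hVm hWm).1 (hF.2.1 V hV W hW)

theorem mem_padColl {X : Finset ℕ} (hX : X ∈ F) (hm : #X = m) : X ∈ padColl n m F :=
  mem_image.2 ⟨X, mem_filter.2 ⟨hX, hm.le⟩, pad_eq_self hm.ge⟩

/-- Exchange between two members `C ∪ {i}` and `C ∪ {b}` of a maximal w-collection. -/
theorem exists_exchange (hF : IsMaxWColl {X : Finset ℕ | X ⊆ Icc 1 n} F)
    (hIcc : ∀ s, 1 ≤ s → s + m ≤ n → Icc s (s + m) ∈ F) {C : Finset ℕ} (hC : #C = m) {i b : ℕ}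
    (hib : i < b) (hi : i ∉ C) (hb : b ∉ C) (hiF : insert i C ∈ F) (hbF : insert b C ∈ F) :
    (∃ x, x ∉ C ∧ (i < x ∧ x < b) ∧ insert x C ∈ F) ∨
    (∃ y ∈ C, (y < i ∨ b < y) ∧ (insert i (insert b C)).erase y ∈ F) ∨ C = Ioo i b := by
  by_cases hne : (∃ x, x ∉ C ∧ i < x ∧ x < b) ∨ ∃ y ∈ C, y < i ∨ b < y
  swap
  · push Not at hne
    right; right
    ext t
    rw [mem_Ioo]
    constructor
    · intro ht
      have := hne.2 t ht
      have : t ≠ i := by rintro rfl; exact hi ht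
      have : t ≠ b := by rintro rfl; exact hb ht
      omega
    · intro ht
      by_contra h
      have := hne.1 t h ht.1
      omega
  have hin : insert i C ⊆ Icc 1 n := hF.1 hiF
  have hbn : insert b C ⊆ Icc 1 n := hF.1 hbF
  have hibn : insert i (insert b C) ⊆ Icc 1 n :=
    insert_subset (hin (mem_insert_self _ _)) hbn
  have hcard : ∀ x, x ∉ C → #(insert x C) = m + 1 := fun x hx => by
    rw [card_insert_of_notMem hx, hC]
  rcases exists_edge_exchange hib hi hb (F := padColl n (m + 1) F)
    (fun V hV => by rw [card_of_mem_padColl hF hV, hC])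
    (fun V hV W hW => altFree_of_mem_padColl hF hV hW) (mem_padColl hiF (hcard i hi))
    (mem_padColl hbF (hcard b hb)) hne with ⟨x, hx, hx', h⟩ | ⟨y, hy, hy', h⟩
  · refine Or.inl ⟨x, hx, hx', mem_of_altFree_padColl hF hIcc ?_ (hcard x hx).le ?_⟩
    · refine insert_subset ?_ ((subset_insert _ _).trans hin)
      have h1 := mem_Icc.1 (hin (mem_insert_self _ _))
      have h2 := mem_Icc.1 (hbn (mem_insert_self _ _))
      exact mem_Icc.2 ⟨by omega, by omega⟩
    · rwa [pad_eq_self (hcard x hx).ge]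
  · have hc : #((insert i (insert b C)).erase y) = m + 1 := by
      rw [card_erase_of_mem (by simp [hy]), card_insert_of_notMem (by simp [hi, hib.ne]),
        hcard b hb]
      rfl
    refine Or.inr (Or.inl ⟨y, hy, hy', mem_of_altFree_padColl hF hIcc
      ((erase_subset _ _).trans hibn) hc.le ?_⟩)
    rwa [pad_eq_self hc.ge]

/-- Exchange between members `C` and `C ∪ {i}` of a maximal w-collection. -/
theorem exists_exchange_top (hF : IsMaxWColl {X : Finset ℕ | X ⊆ Icc 1 n} F)
    (hIcc : ∀ s, 1 ≤ s → s + m ≤ n → Icc s (s + m) ∈ F) {C : Finset ℕ} (hC : #C = m) {i : ℕ}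
    (hi : i ∉ C) (hCF : C ∈ F) (hiF : insert i C ∈ F) :
    (∃ x, x ∉ C ∧ i < x ∧ insert x C ∈ F) ∨
    (∃ y ∈ C, y < i ∧ (insert i C).erase y ∈ F) ∨ C = Ioc i n := by
  have hin : insert i C ⊆ Icc 1 n := hF.1 hiF
  have hin' := mem_Icc.1 (hin (mem_insert_self _ _))
  have hCn : C ⊆ Icc 1 n := hF.1 hCF
  by_cases hne : (∃ x, x ∉ C ∧ i < x ∧ x < n + 1) ∨ ∃ y ∈ C, y < i ∨ n + 1 < y
  swap
  · push Not at hne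
    right; right
    ext t
    rw [mem_Ioc]
    constructor
    · intro ht
      have := hne.2 t ht
      have : t ≠ i := by rintro rfl; exact hi ht
      have := mem_Icc.1 (hCn ht)
      omega
    · intro ht
      by_contra h
      have := hne.1 t h ht.1
      omega
  have htop : n + 1 ∉ C := fun h => by simpa using hCn h
  have hcard : ∀ x, x ∉ C → #(insert x C) = m + 1 := fun x hx => by
    rw [card_insert_of_notMem hx, hC]
  rcases exists_edge_exchange (b := n + 1) (by omega) hi htop (F := padColl n (m + 1) F)
    (fun V hV => by rw [card_of_mem_padColl hF hV, hC])
    (fun V hV W hW => altFree_of_mem_padColl hF hV hW) (mem_padColl hiF (hcard i hi))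
    (by
      rw [← pad_succ_card, hC]
      exact mem_image_of_mem _ (mem_filter.2 ⟨hCF, by omega⟩)) hne with
    ⟨x, hx, hx', h⟩ | ⟨y, hy, hy', h⟩
  · refine Or.inl ⟨x, hx, hx'.1, mem_of_altFree_padColl hF hIcc ?_ (hcard x hx).le ?_⟩
    · exact insert_subset (mem_Icc.2 ⟨by omega, by omega⟩) hCn
    · rwa [pad_eq_self (hcard x hx).ge]
  · have hy2 : y ≤ n := (mem_Icc.1 (hCn hy)).2
    have hc : #((insert i C).erase y) = m := by
      rw [card_erase_of_mem (by simp [hy]), hcard i hi]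
      rfl
    refine Or.inr (Or.inl ⟨y, hy, by omega, mem_of_altFree_padColl hF hIcc
      ((erase_subset _ _).trans hin) (by omega) ?_⟩)
    have : pad n (m + 1) ((insert i C).erase y) = (insert i (insert (n + 1) C)).erase y := by
      have h1 := pad_succ_card (n := n) ((insert i C).erase y)
      rw [hc] at h1
      rw [h1, insert_comm i, erase_insert_of_ne (a := n + 1) (by omega)]
    rwa [this]

end Descent

section Main

variable {n m : ℕ} {F : Finset (Finset ℕ)}

/-- The family contains the five sets of a lowering flip. -/
def HasLowering (F : Finset (Finset ℕ)) : Prop :=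
  ∃ i j k : ℕ, ∃ A : Finset ℕ, i < j ∧ j < k ∧ i ∉ A ∧ j ∉ A ∧ k ∉ A ∧
    insert i A ∈ F ∧ insert k A ∈ F ∧ insert i (insert j A) ∈ F ∧
    insert j (insert k A) ∈ F ∧ insert i (insert k A) ∈ F

/-- `X` is an interval of size `m + 1`, and all intervals of size `m` starting no later are in
the family. -/
def IntervalTag (m : ℕ) (F : Finset (Finset ℕ)) (X : Finset ℕ) : Prop :=
  ∃ p, X = Icc p (p + m) ∧ ∀ q, 1 ≤ q → q ≤ p → Ico q (q + m) ∈ F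

/-- An exchange `k → α` below `X`, together with an exchange `z → α` at the level of `X`. -/
def ExchangeTag (F : Finset (Finset ℕ)) (X : Finset ℕ) : Prop :=
  ∃ α k z, α ∉ X ∧ k ∈ X ∧ α < k ∧ X.erase k ∈ F ∧ insert α (X.erase k) ∈ F ∧ z ∈ X ∧ z < α ∧
    (insert α X).erase z ∈ F

theorem not_exchangeTag_Icc {p q : ℕ} : ¬ ExchangeTag F (Icc p q) := by
  rintro ⟨α, k, z, h1, h2, h3, -, -, h4, h5, -⟩
  simp only [mem_Icc] at *
  omega

/-- An exchange tag at `C ∪ {i}` excludes an upper exchange at `C ∪ {i, b}`, `i < b < w`. -/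
theorem ExchangeTag.false (hF : IsMaxWColl {X : Finset ℕ | X ⊆ Icc 1 n} F)
    (hno : ¬ HasLowering F) {C : Finset ℕ} {i b w : ℕ} (hi : i ∉ C) (hb : b ∉ C) (hib : i < b)
    (hCF : C ∈ F) (hiF : insert i C ∈ F) (hbF : insert b C ∈ F) (hw : w ∈ C) (hbw : b < w)
    (hwF : (insert i (insert b C)).erase w ∈ F) (hX : ExchangeTag F (insert i C)) : False := by
  obtain ⟨α, k, z, hα, hk, hαk, hkF, hαF, hz, hzα, hzF⟩ := hX
  rcases lt_trichotomy α b with hαb | rfl | hαb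
  · refine (hF.2.1 _ hwF _ hzF).altFree.cyc (p := z) (q := α) (r := b) (s := w)
      (Or.inl ⟨hzα, hαb, hbw⟩) ?_ ?_ ?_ ?_ ?_ ?_ ?_ ?_ <;>
      simp only [mem_coe, mem_erase, mem_insert] at * <;> grind
  · have hki : k ≠ i := by omega
    have hkC : k ∈ C := (mem_insert.1 hk).resolve_left hki
    refine hno ⟨i, α, k, C.erase k, hib, hαk, fun h => hi (mem_of_mem_erase h),
      fun h => hb (mem_of_mem_erase h), notMem_erase _ _, ?_, ?_, ?_, ?_, ?_⟩
    · rwa [← erase_insert_of_ne hki.symm]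
    · rwa [insert_erase hkC]
    · rwa [insert_comm, ← erase_insert_of_ne hki.symm]
    · rwa [insert_erase hkC]
    · rwa [insert_erase hkC]
  · refine (hF.2.1 _ hαF _ hbF).altFree.cyc (p := i) (q := b) (r := α) (s := k)
      (Or.inl ⟨hib, hαb, hαk⟩) ?_ ?_ ?_ ?_ ?_ ?_ ?_ ?_ <;>
      simp only [mem_coe, mem_erase, mem_insert] at * <;> grind

theorem descent_false (hF : IsMaxWColl {X : Finset ℕ | X ⊆ Icc 1 n} F) (hm : 1 ≤ m)
    (hIcc : ∀ s, 1 ≤ s → s + m ≤ n → Icc s (s + m) ∈ F)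
    (hmiss : ∃ q, 1 ≤ q ∧ q + m ≤ n + 1 ∧ Ico q (q + m) ∉ F) (hno : ¬ HasLowering F)
    (C : Finset ℕ) (i : ℕ) (hC : #C = m) (hi : i ∉ C) (hCF : C ∈ F) (hiF : insert i C ∈ F)
    (htag : IntervalTag m F (insert i C) ∨ ExchangeTag F (insert i C)) : False := by
  have hCn : C ⊆ Icc 1 n := hF.1 hCF
  have hin : i ≤ n := (mem_Icc.1 (hF.1 hiF (mem_insert_self _ _))).2
  have hsum : ∀ D : Finset ℕ, D ⊆ Icc 1 n → ∑ x ∈ D, x ≤ ∑ x ∈ Icc 1 n, x := fun D hD =>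
    sum_le_sum_of_subset hD
  rcases exists_exchange_top hF hIcc hC hi hCF hiF with hΔ | ⟨y, hy, hyi, hyF⟩ | hlast
  · classical
    let b := Nat.find hΔ
    obtain ⟨hb, hib, hbF⟩ : b ∉ C ∧ i < b ∧ insert b C ∈ F := Nat.find_spec hΔ
    have hmin : ∀ x, x ∉ C → i < x → insert x C ∈ F → b ≤ x := fun x h1 h2 h3 =>
      Nat.find_min' hΔ ⟨h1, h2, h3⟩
    clear_value b
    have hbn : b ≤ n := (mem_Icc.1 (hF.1 hbF (mem_insert_self _ _))).2
    refine descent_false hF hm hIcc hmiss hno C b hC hb hCF hbF ?_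
    rcases exists_exchange hF hIcc hC hib hi hb hiF hbF with
      ⟨x, hx, hx', hxF⟩ | ⟨y, hy, hy' | hy', hyF⟩ | hIoo
    · exact absurd (hmin x hx hx'.1 hxF) (by omega)
    · refine Or.inr ⟨i, b, y, by simp [hi, hib.ne], mem_insert_self _ _, hib, ?_, ?_,
        mem_insert_of_mem hy, hy', hyF⟩
      · rwa [erase_insert hb]
      · rwa [erase_insert hb]
    · exfalso
      rcases htag with ⟨p, hp, -⟩ | htag
      · have h1 : i ∈ Icc p (p + m) := hp ▸ mem_insert_self _ _
        have h2 : y ∈ Icc p (p + m) := hp ▸ mem_insert_of_mem hy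
        have h3 : b ∈ insert i C := by
          rw [hp]
          simp only [mem_Icc] at *
          omega
        exact (mem_insert.1 h3).elim hib.ne' hb
      · exact htag.false hF hno hi hb hib hCF hiF hbF hy hy' hyF
    · have hbi : b = i + m + 1 := by
        rw [hIoo, Nat.card_Ioo] at hC
        omega
      have hX : insert i C = Icc i (i + m) := by
        ext t
        simp only [hIoo, mem_insert, mem_Ioo, mem_Icc]
        omega
      rcases htag with ⟨p, hp, hpF⟩ | htag
      · have hpi : p = i := by
          rw [hX] at hp
          have h1 : i ∈ Icc p (p + m) := hp ▸ left_mem_Icc.2 (by omega)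
          have h2 : p ∈ Icc i (i + m) := hp ▸ left_mem_Icc.2 (by omega)
          simp only [mem_Icc] at h1 h2
          omega
        refine Or.inl ⟨i + 1, ?_, fun q hq hqi => ?_⟩
        · ext t
          simp only [hIoo, mem_insert, mem_Ioo, mem_Icc]
          omega
        · rcases hqi.eq_or_lt with rfl | hlt
          · convert hCF using 1
            ext t
            simp only [hIoo, mem_Ioo, mem_Ico]
            omega
          · exact hpF q hq (by omega)
      · rw [hX] at htag
        exact absurd htag not_exchangeTag_Icc
  · have hyX : y ∈ insert i C := mem_insert_of_mem hy
    have hins : insert y ((insert i C).erase y) = insert i C := insert_erase hyX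
    have hs1 : ∑ x ∈ (insert i C).erase y, x + y = ∑ x ∈ C, x + i := by
      rw [sum_erase_add _ _ hyX, sum_insert hi, add_comm]
    have hs2 := hsum _ (hF.1 hyF)
    refine descent_false hF hm hIcc hmiss hno ((insert i C).erase y) y ?_ (notMem_erase _ _) hyF
      (by rwa [hins]) (by rwa [hins])
    rw [card_erase_of_mem hyX, card_insert_of_notMem hi, hC]
    rfl
  · have hX : insert i C = Icc i n := by
      ext t
      simp only [hlast, mem_insert, mem_Ioc, mem_Icc]
      omega
    have hnm : n = i + m := by
      rw [hlast, Nat.card_Ioc] at hC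
      omega
    rcases htag with ⟨p, hp, hpF⟩ | htag
    · obtain ⟨q, hq, hqn, hqF⟩ := hmiss
      have hpi : p = i := by
        rw [hX] at hp
        have h1 : i ∈ Icc p (p + m) := hp ▸ left_mem_Icc.2 (by omega)
        have h2 : p ∈ Icc i n := hp ▸ left_mem_Icc.2 (by omega)
        simp only [mem_Icc] at h1 h2
        omega
      rcases le_or_gt q i with h | h
      · exact hqF (hpF q hq (by omega))
      · refine hqF ?_
        convert hCF using 1
        ext t
        simp only [hlast, mem_Ioc, mem_Ico]
        omega
    · rw [hX] at htag
      exact absurd htag not_exchangeTag_Icc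
termination_by (∑ x ∈ Icc 1 n, x - ∑ x ∈ C, x, n - i)
decreasing_by
  · exact Prod.Lex.right _ (by omega)
  · exact Prod.Lex.left _ _ (by omega)

theorem hasLowering_of_ne_intervalColl (hF : IsMaxWColl {X : Finset ℕ | X ⊆ Icc 1 n} F)
    (hne : F ≠ IntervalColl n) : HasLowering F := by
  by_contra hno
  have hmissing : (IntervalColl n \ F).Nonempty := by
    rw [sdiff_nonempty]
    exact fun hsub => hne (isMaxWColl_intervalColl.2.2 F hF.1 hF.2.1 hsub).symm
  obtain ⟨J, hJ, hmax⟩ := exists_max_image _ (fun X => #X) hmissing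
  obtain ⟨hJI, hJF⟩ := mem_sdiff.1 hJ
  have hJ' : ∃ p q, 1 ≤ p ∧ p ≤ q ∧ q ≤ n ∧ J = Icc p q := by
    simp only [IntervalColl, mem_insert, mem_image, mem_product, mem_Icc, Prod.exists] at hJI
    rcases hJI with rfl | ⟨p, q, h, rfl⟩
    · exact absurd (Icc_one_mem hF (Nat.zero_le n)) (by simpa using hJF)
    · refine ⟨p, q, h.1.1, ?_, h.2.2, rfl⟩
      by_contra hpq
      rw [Icc_eq_empty hpq] at hJF
      exact absurd (Icc_one_mem hF (Nat.zero_le n)) (by simpa using hJF)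
  obtain ⟨p, q, hp, hpq, hqn, rfl⟩ := hJ'
  obtain ⟨m, rfl⟩ : ∃ m, q = p + m := ⟨q - p, by omega⟩
  have hIcc : ∀ s, 1 ≤ s → s + (m + 1) ≤ n → Icc s (s + (m + 1)) ∈ F := by
    intro s hs hsn
    by_contra hsF
    have := hmax (Icc s (s + (m + 1))) (mem_sdiff.2 ⟨?_, hsF⟩)
    · simp only [Nat.card_Icc] at this
      omega
    · rw [mem_intervalColl]
      refine ⟨Icc_subset_Icc hs hsn, fun x hx z hz y hxy hyz => ?_⟩
      simp only [mem_Icc] at *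
      omega
  have hmn : m + 2 ≤ n := by
    by_contra h
    have : p = 1 := by omega
    subst this
    exact hJF (Icc_one_mem hF hqn)
  have hX : insert (m + 2) (Icc 1 (m + 1)) = Icc 1 (1 + (m + 1)) := by
    ext t
    simp only [mem_insert, mem_Icc]
    omega
  refine descent_false hF (m := m + 1) (by omega) hIcc ⟨p, hp, by omega, ?_⟩ hno (Icc 1 (m + 1))
    (m + 2) (by simp) (by simp) (Icc_one_mem hF (by omega)) ?_ (Or.inl ⟨1, hX, ?_⟩)
  · have : Ico p (p + (m + 1)) = Icc p (p + m) := by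
      ext t
      simp only [mem_Ico, mem_Icc]
      omega
    rwa [this]
  · rw [hX]
    exact Icc_one_mem hF (by omega)
  · intro q hq1 hq2
    obtain rfl : q = 1 := by omega
    convert Icc_one_mem hF (p := m + 1) (by omega) using 1
    ext t
    simp only [mem_Ico, mem_Icc]
    omega

theorem exists_flip_sequence (N : ℕ) : ∀ F : Finset (Finset ℕ), ∑ X ∈ F, #X = N →
    IsMaxWColl {X : Finset ℕ | X ⊆ Icc 1 n} F →
      ∃ (t : ℕ) (Fs : ℕ → Finset (Finset ℕ)),
        Fs 0 = IntervalColl n ∧ Fs t = F ∧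
        (∀ s ≤ t, IsMaxWColl {X : Finset ℕ | X ⊆ Icc 1 n} (Fs s)) ∧
        (∀ s < t, WeakRaisingFlip n (Fs s) (Fs (s + 1))) := by
  induction N using Nat.strong_induction_on with
  | _ N ih =>
    intro F hN hF
    by_cases hne : F = IntervalColl n
    · exact ⟨0, fun _ => F, hne, rfl, fun _ _ => hF, fun s hs => absurd hs (Nat.not_lt_zero s)⟩
    obtain ⟨i, j, k, A, hij, hjk, hi, hj, hk, h1, h2, h3, h4, h5⟩ :=
      hasLowering_of_ne_intervalColl hF hne
    obtain ⟨F', hF', hflip, hlt⟩ := exists_lowering hF hij hjk hi hj hk h1 h2 h3 h4 h5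
    obtain ⟨t, Fs, hs0, hst, hsmax, hsflip⟩ := ih _ (hN ▸ hlt) F' rfl hF'
    refine ⟨t + 1, fun s => if s ≤ t then Fs s else F, by simpa using hs0, by simp,
      fun s _ => ?_, fun s hs => ?_⟩
    · dsimp only
      split_ifs with h
      · exact hsmax s h
      · exact hF
    · rcases (Nat.lt_succ_iff.1 hs).eq_or_lt with rfl | h
      · simpa [hst] using hflip
      · simpa [h.le, Nat.succ_le_of_lt h] using hsflip s h

end Main

/-- every maximal w-collection in `2^[n]` is reachable from `I_n`
by a finite sequence of weak raising flips through maximal w-collections; in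
particular `I_n` is itself a maximal w-collection. -/
theorem max_w_collection_reachable_from_intervals (n : ℕ) (hn : 1 ≤ n) :
    IsMaxWColl {X : Finset ℕ | X ⊆ Finset.Icc 1 n} (IntervalColl n) ∧
    ∀ F : Finset (Finset ℕ), IsMaxWColl {X : Finset ℕ | X ⊆ Finset.Icc 1 n} F →
      ∃ (t : ℕ) (Fs : ℕ → Finset (Finset ℕ)),
        Fs 0 = IntervalColl n ∧ Fs t = F ∧
        (∀ s ≤ t, IsMaxWColl {X : Finset ℕ | X ⊆ Finset.Icc 1 n} (Fs s)) ∧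
        (∀ s < t, WeakRaisingFlip n (Fs s) (Fs (s + 1))) :=
  ⟨isMaxWColl_intervalColl, fun F hF => exists_flip_sequence _ F rfl hF⟩
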